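/- arXiv:1605.07170 — 3 statements merged into one kernel-verified Lean document; each statement's English description precedes it below -/
import Mathlib

section
/- Let $A \subseteq \mathbb{R}^n$ be a compact convex set with $\mu(A) > 0$, let $B \subseteq \mathbb{R}^n$ be a nonempty compact set, and set $\alpha = \mu(B)/\mu(A)$. Then $\mu(A+B)^2 \ge \mu(B)\, \mu(A-A) \sum_{k=1}^{n} \alpha^{-k/n} \frac{(n!)^2}{(n-k)!\,(n+k)!}$. -/
open MeasureTheory Pointwise
open scoped ENNReal

theorem volume_add_le_of_isCompact {K L : Set ℝ} (hK : IsCompact K) (hL : IsCompact L)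
    (hKn : K.Nonempty) (hLn : L.Nonempty) : volume K + volume L ≤ volume (K + L) := by
  have hx := hK.sSup_mem hKn
  have hy := hL.sInf_mem hLn
  set x := sSup K
  set y := sInf L
  have h1 : volume ((fun z => z + y) '' K) = volume K := by
    rw [Set.image_add_right, measure_preimage_add_right]
  have h2 : volume ((fun z => x + z) '' L) = volume L := by
    rw [Set.image_add_left, measure_preimage_add]
  have hdisj : AEDisjoint volume ((fun z => z + y) '' K) ((fun z => x + z) '' L) := by
    refine measure_mono_null (t := {x + y}) ?_ (by simp)
    rintro _ ⟨⟨a, ha, rfl⟩, ⟨b, hb, hab⟩⟩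
    have h3 : a ≤ x := le_csSup hK.bddAbove ha
    have h4 : y ≤ b := csInf_le hL.bddBelow hb
    simp only [Set.mem_singleton_iff] at hab ⊢
    linarith
  have hm : NullMeasurableSet ((fun z => x + z) '' L) volume :=
    (hL.image (by fun_prop)).measurableSet.nullMeasurableSet
  rw [← h1, ← h2, ← measure_union₀ hm hdisj]
  refine measure_mono (Set.union_subset ?_ ?_)
  · rintro _ ⟨a, ha, rfl⟩
    exact Set.add_mem_add ha hy
  · rintro _ ⟨a, ha, rfl⟩
    exact Set.add_mem_add hx ha

theorem volume_add_le_of_measurableSet {X Y : Set ℝ} (hX : MeasurableSet X)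
    (hY : MeasurableSet Y) (hXn : X.Nonempty) (hYn : Y.Nonempty) :
    volume X + volume Y ≤ volume (X + Y) := by
  obtain ⟨x, hx⟩ := hXn
  obtain ⟨y, hy⟩ := hYn
  have key : ∀ K ⊆ X, IsCompact K → ∀ L ⊆ Y, IsCompact L →
      volume K + volume L ≤ volume (X + Y) := by
    intro K hKX hK L hLY hL
    calc volume K + volume L ≤ volume (insert x K) + volume (insert y L) := by
          gcongr <;> exact Set.subset_insert _ _
      _ ≤ volume (insert x K + insert y L) :=
          volume_add_le_of_isCompact (hK.insert x) (hL.insert y)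
            (Set.insert_nonempty _ _) (Set.insert_nonempty _ _)
      _ ≤ volume (X + Y) := measure_mono (Set.add_subset_add
          (Set.insert_subset hx hKX) (Set.insert_subset hy hLY))
  rw [hX.measure_eq_iSup_isCompact, hY.measure_eq_iSup_isCompact]
  simp only [iSup_and']
  refine ENNReal.biSup_add_biSup_le' ⟨∅, by simp⟩ ⟨∅, by simp⟩ ?_
  exact fun K hK L hL => key K hK.1 hK.2 L hL.1 hL.2

theorem lintegral_eq_lintegral_Ioo_meas_lt {α : Type*} [MeasurableSpace α] (μ : Measure α)
    {f : α → ℝ≥0∞} (hf : Measurable f) (hf1 : ∀ x, f x ≤ 1) :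
    ∫⁻ x, f x ∂μ = ∫⁻ t in Set.Ioo (0 : ℝ) 1, μ {x | ENNReal.ofReal t < f x} := by
  have hfin : ∀ x, f x ≠ ∞ := fun x => ne_top_of_le_ne_top ENNReal.one_ne_top (hf1 x)
  have h := lintegral_eq_lintegral_meas_lt μ (f := fun x => (f x).toReal)
    (Filter.Eventually.of_forall fun x => ENNReal.toReal_nonneg) hf.ennreal_toReal.aemeasurable
  simp only [ENNReal.ofReal_toReal (hfin _)] at h
  rw [h, ← lintegral_indicator measurableSet_Ioi, ← lintegral_indicator measurableSet_Ioo]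
  refine lintegral_congr fun t => ?_
  by_cases h0 : 0 < t
  · have hset : {x | t < (f x).toReal} = {x | ENNReal.ofReal t < f x} := by
      ext x
      exact (ENNReal.ofReal_lt_iff_lt_toReal h0.le (hfin x)).symm
    by_cases h1 : t < 1
    · rw [Set.indicator_of_mem (by exact h0), Set.indicator_of_mem (by exact ⟨h0, h1⟩), hset]
    · rw [Set.indicator_of_mem (by exact h0),
        Set.indicator_of_notMem (fun h => h1 h.2), hset]
      convert measure_empty (μ := μ)
      ext x
      simp only [Set.mem_ofPred_eq, Set.mem_empty_iff_false, iff_false, not_lt]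
      exact (hf1 x).trans (ENNReal.one_le_ofReal.2 (not_lt.1 h1))
  · rw [Set.indicator_of_notMem (by exact h0), Set.indicator_of_notMem (fun h => h0 h.1)]

theorem ENNReal.rpow_mul_rpow_le_add {p q : ℝ} (hp : 0 < p) (hq : 0 < q) (hpq : p + q = 1)
    (a b : ℝ≥0∞) : a ^ p * b ^ q ≤ ENNReal.ofReal p * a + ENNReal.ofReal q * b := by
  induction a with
  | top => simp [ENNReal.mul_top, hp]
  | coe a =>
    induction b with
    | top => simp [ENNReal.mul_top, hq]
    | coe b =>
      have h := NNReal.geom_mean_le_arith_mean2_weighted p.toNNReal q.toNNReal a b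
        (by rw [← Real.toNNReal_add hp.le hq.le, hpq, Real.toNNReal_one])
      rw [Real.coe_toNNReal _ hp.le, Real.coe_toNNReal _ hq.le] at h
      rw [← ENNReal.coe_rpow_of_nonneg _ hp.le, ← ENNReal.coe_rpow_of_nonneg _ hq.le]
      simp only [ENNReal.ofReal]
      exact_mod_cast h

theorem prekopa_leindler_real_of_iSup_eq_one {p q : ℝ} (hp : 0 < p) (hq : 0 < q)
    (hpq : p + q = 1) {f g h : ℝ → ℝ≥0∞} (hf : Measurable f) (hg : Measurable g)
    (hh : Measurable h) (hfgh : ∀ x y, f x ^ p * g y ^ q ≤ h (p • x + q • y))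
    (hf1 : ⨆ x, f x = 1) (hg1 : ⨆ x, g x = 1) :
    ENNReal.ofReal p * (∫⁻ x, f x) + ENNReal.ofReal q * ∫⁻ x, g x ≤ ∫⁻ x, h x := by
  have hfle : ∀ x, f x ≤ 1 := fun x => hf1 ▸ le_iSup f x
  have hgle : ∀ x, g x ≤ 1 := fun x => hg1 ▸ le_iSup g x
  calc ENNReal.ofReal p * (∫⁻ x, f x) + ENNReal.ofReal q * ∫⁻ x, g x
      ≤ ∫⁻ x, min (h x) 1 := ?_
    _ ≤ ∫⁻ x, h x := lintegral_mono fun x => min_le_left _ _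
  rw [lintegral_eq_lintegral_Ioo_meas_lt volume hf hfle,
    lintegral_eq_lintegral_Ioo_meas_lt volume hg hgle,
    lintegral_eq_lintegral_Ioo_meas_lt volume (hh.min measurable_const) fun x => min_le_right _ _,
    ← lintegral_const_mul' _ _ ENNReal.ofReal_ne_top,
    ← lintegral_const_mul' _ _ ENNReal.ofReal_ne_top]
  refine (le_lintegral_add _ _).trans (setLIntegral_mono' measurableSet_Ioo fun t ht => ?_)
  have ht1 : ENNReal.ofReal t < 1 := by simpa using ht.2
  have hXn : {x | ENNReal.ofReal t < f x}.Nonempty :=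
    let ⟨x, hx⟩ := lt_iSup_iff.1 (hf1.symm ▸ ht1); ⟨x, hx⟩
  have hYn : {x | ENNReal.ofReal t < g x}.Nonempty :=
    let ⟨x, hx⟩ := lt_iSup_iff.1 (hg1.symm ▸ ht1); ⟨x, hx⟩
  have hX : MeasurableSet {x | ENNReal.ofReal t < f x} := measurableSet_lt measurable_const hf
  have hY : MeasurableSet {x | ENNReal.ofReal t < g x} := measurableSet_lt measurable_const hg
  have hvol : ∀ {r : ℝ} (_ : 0 < r) (s : Set ℝ),
      volume (r • s) = ENNReal.ofReal r * volume s := fun {r} hr s => by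
    rw [Measure.addHaar_smul]; simp [abs_of_pos hr]
  rw [← hvol hp, ← hvol hq]
  refine (volume_add_le_of_measurableSet (hX.const_smul₀ p) (hY.const_smul₀ q) hXn.smul_set
    hYn.smul_set).trans (measure_mono ?_)
  rintro _ ⟨_, ⟨x, hx, rfl⟩, _, ⟨y, hy, rfl⟩, rfl⟩
  refine lt_min ?_ ht1
  calc ENNReal.ofReal t = ENNReal.ofReal t ^ p * ENNReal.ofReal t ^ q := by
        rw [← ENNReal.rpow_add _ _ (by simpa using ht.1) ENNReal.ofReal_ne_top, hpq,
          ENNReal.rpow_one]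
    _ < f x ^ p * g y ^ q :=
        ENNReal.mul_lt_mul (ENNReal.rpow_lt_rpow hx hp) (ENNReal.rpow_lt_rpow hy hq)
    _ ≤ _ := hfgh x y

theorem prekopa_leindler_real_of_iSup_ne_top {p q : ℝ} (hp : 0 < p) (hq : 0 < q)
    (hpq : p + q = 1) {f g h : ℝ → ℝ≥0∞} (hf : Measurable f) (hg : Measurable g)
    (hh : Measurable h) (hfgh : ∀ x y, f x ^ p * g y ^ q ≤ h (p • x + q • y))
    (hft : ⨆ x, f x ≠ ∞) (hgt : ⨆ x, g x ≠ ∞) :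
    (∫⁻ x, f x) ^ p * (∫⁻ x, g x) ^ q ≤ ∫⁻ x, h x := by
  rcases eq_or_ne (⨆ x, f x) 0 with hf0 | hf0
  · simp [ENNReal.iSup_eq_zero.1 hf0, hp]
  rcases eq_or_ne (⨆ x, g x) 0 with hg0 | hg0
  · simp [ENNReal.iSup_eq_zero.1 hg0, hq]
  set F := ⨆ x, f x
  set G := ⨆ x, g x
  have hC0 : F ^ p * G ^ q ≠ 0 := by simp [hf0, hg0, hft, hgt]
  have hCt : F ^ p * G ^ q ≠ ∞ := ENNReal.mul_ne_top
    (ENNReal.rpow_ne_top_of_nonneg hp.le hft) (ENNReal.rpow_ne_top_of_nonneg hq.le hgt)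
  have hscale : ∀ a b : ℝ≥0∞, (F⁻¹ * a) ^ p * (G⁻¹ * b) ^ q
      = (F ^ p * G ^ q)⁻¹ * (a ^ p * b ^ q) := fun a b => by
    rw [ENNReal.mul_rpow_of_nonneg _ _ hp.le, ENNReal.mul_rpow_of_nonneg _ _ hq.le,
      ENNReal.inv_rpow, ENNReal.inv_rpow, ENNReal.mul_inv (by simp [hf0, hft]) (by simp [hg0, hgt])]
    ring
  have h1 := prekopa_leindler_real_of_iSup_eq_one hp hq hpq (f := fun x => F⁻¹ * f x)
    (g := fun x => G⁻¹ * g x) (h := fun x => (F ^ p * G ^ q)⁻¹ * h x) (hf.const_mul _)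
    (hg.const_mul _) (hh.const_mul _)
    (fun x y => by rw [hscale]; gcongr; exact hfgh x y)
    (by rw [← ENNReal.mul_iSup, ENNReal.inv_mul_cancel hf0 hft])
    (by rw [← ENNReal.mul_iSup, ENNReal.inv_mul_cancel hg0 hgt])
  have h2 := (ENNReal.rpow_mul_rpow_le_add hp hq hpq _ _).trans h1
  rw [lintegral_const_mul _ hf, lintegral_const_mul _ hg, lintegral_const_mul _ hh, hscale] at h2
  exact (ENNReal.mul_le_mul_iff_right (ENNReal.inv_ne_zero.2 hCt) (ENNReal.inv_ne_top.2 hC0)).1 h2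

theorem tendsto_lintegral_min_natCast {α : Type*} [MeasurableSpace α] (μ : Measure α)
    {f : α → ℝ≥0∞} (hf : Measurable f) :
    Filter.Tendsto (fun N : ℕ => ∫⁻ x, min (f x) N ∂μ) Filter.atTop (nhds (∫⁻ x, f x ∂μ)) := by
  refine lintegral_tendsto_of_tendsto_of_monotone
    (fun N => (hf.min measurable_const).aemeasurable)
    (Filter.Eventually.of_forall fun x M N hMN => ?_) (Filter.Eventually.of_forall fun x => ?_)
  · exact min_le_min_left _ (Nat.cast_le.2 hMN)
  · simpa using (tendsto_const_nhds (x := f x)).min ENNReal.tendsto_nat_nhds_top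

theorem prekopa_leindler_real {p q : ℝ} (hp : 0 < p) (hq : 0 < q)
    (hpq : p + q = 1) {f g h : ℝ → ℝ≥0∞} (hf : Measurable f) (hg : Measurable g)
    (hh : Measurable h) (hfgh : ∀ x y, f x ^ p * g y ^ q ≤ h (p • x + q • y)) :
    (∫⁻ x, f x) ^ p * (∫⁻ x, g x) ^ q ≤ ∫⁻ x, h x := by
  rcases eq_or_ne (∫⁻ x, f x) 0 with hf0 | hf0
  · simp [hf0, hp]
  rcases eq_or_ne (∫⁻ x, g x) 0 with hg0 | hg0
  · simp [hg0, hq]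
  have hbdd : ∀ (N : ℕ) (k : ℝ → ℝ≥0∞), ⨆ x, min (k x) N ≠ ∞ := fun N k =>
    ne_top_of_le_ne_top (ENNReal.natCast_ne_top N) (iSup_le fun x => min_le_right _ _)
  refine le_of_tendsto (ENNReal.Tendsto.mul
    ((ENNReal.continuous_rpow_const (y := p)).continuousAt.tendsto.comp
      (tendsto_lintegral_min_natCast volume hf)) (Or.inl (by simp [hf0, hp.not_gt]))
    ((ENNReal.continuous_rpow_const (y := q)).continuousAt.tendsto.comp
      (tendsto_lintegral_min_natCast volume hg)) (Or.inl (by simp [hg0, hq.not_gt])))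
    (Filter.Eventually.of_forall fun N => ?_)
  refine prekopa_leindler_real_of_iSup_ne_top hp hq hpq (hf.min measurable_const)
    (hg.min measurable_const) hh (fun x y => le_trans ?_ (hfgh x y)) (hbdd N f) (hbdd N g)
  gcongr <;> exact min_le_left _ _

theorem lintegral_fin_succ {n : ℕ} {f : (Fin (n + 1) → ℝ) → ℝ≥0∞} (hf : Measurable f) :
    ∫⁻ x, f x = ∫⁻ s : ℝ, ∫⁻ y : Fin n → ℝ, f (Fin.cons s y) := by
  have h := (volume_preserving_piFinSuccAbove (fun _ : Fin (n + 1) => ℝ) 0).symm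
  rw [← h.lintegral_comp hf, Measure.volume_eq_prod,
    lintegral_prod (fun z => f ((MeasurableEquiv.piFinSuccAbove (fun _ => ℝ) 0).symm z))
      (hf.comp (MeasurableEquiv.measurable _)).aemeasurable]
  simp only [MeasurableEquiv.piFinSuccAbove, MeasurableEquiv.symm_mk, MeasurableEquiv.coe_mk,
    Equiv.symm_symm, Fin.insertNthEquiv_zero]
  rfl

theorem prekopa_leindler {n : ℕ} {p q : ℝ} (hp : 0 < p) (hq : 0 < q) (hpq : p + q = 1)
    {f g h : (Fin n → ℝ) → ℝ≥0∞} (hf : Measurable f) (hg : Measurable g)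
    (hh : Measurable h) (hfgh : ∀ x y, f x ^ p * g y ^ q ≤ h (p • x + q • y)) :
    (∫⁻ x, f x) ^ p * (∫⁻ x, g x) ^ q ≤ ∫⁻ x, h x := by
  induction n with
  | zero =>
    simp only [lintegral_unique, volume_pi, Measure.pi_univ, Finset.univ_eq_empty,
      Finset.prod_empty, mul_one]
    convert hfgh default default
  | succ n ih =>
    have hcons : Measurable fun z : ℝ × (Fin n → ℝ) => (Fin.cons z.1 z.2 : Fin (n + 1) → ℝ) := by
      refine measurable_pi_iff.2 fun i => Fin.cases ?_ (fun j => ?_) i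
      · simpa using measurable_fst
      · simpa using (by fun_prop : Measurable fun z : ℝ × (Fin n → ℝ) => z.2 j)
    have hslice : ∀ s : ℝ, Measurable fun y : Fin n → ℝ => (Fin.cons s y : Fin (n + 1) → ℝ) :=
      fun s => hcons.comp measurable_prodMk_left
    rw [lintegral_fin_succ hf, lintegral_fin_succ hg, lintegral_fin_succ hh]
    refine prekopa_leindler_real hp hq hpq (hf.comp hcons).lintegral_prod_right'
      (hg.comp hcons).lintegral_prod_right' (hh.comp hcons).lintegral_prod_right' fun s t => ?_
    refine ih (hf.comp (hslice s)) (hg.comp (hslice t)) (hh.comp (hslice _)) fun x y => ?_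
    convert hfgh (Fin.cons s x) (Fin.cons t y) using 2
    ext i
    refine Fin.cases ?_ (fun j => ?_) i <;> simp

theorem brunn_minkowski {n : ℕ} {X Y : Set (Fin n → ℝ)} (hX : IsCompact X) (hY : IsCompact Y)
    {a b : ℝ} (ha : 0 < a) (hb : 0 < b) (hXa : volume X = ENNReal.ofReal a ^ n)
    (hYb : volume Y = ENNReal.ofReal b ^ n) :
    ENNReal.ofReal (a + b) ^ n ≤ volume (X + Y) := by
  have hab : 0 < a + b := add_pos ha hb
  have hp : 0 < a / (a + b) := div_pos ha hab
  have hq : 0 < b / (a + b) := div_pos hb hab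
  have hpq : a / (a + b) + b / (a + b) = 1 := by field_simp
  have hvol : ∀ {Z : Set (Fin n → ℝ)} {c : ℝ}, 0 < c → volume Z = ENNReal.ofReal c ^ n →
      volume ((c / (a + b))⁻¹ • Z) = ENNReal.ofReal (a + b) ^ n := fun {Z c} hc hZ => by
    rw [Measure.addHaar_smul, hZ, Module.finrank_fin_fun, abs_of_pos (by positivity),
      ENNReal.ofReal_pow (by positivity), ← mul_pow, ← ENNReal.ofReal_mul (by positivity)]
    congr 2
    field_simp
  have hX' : MeasurableSet ((a / (a + b))⁻¹ • X) := (hX.smul _).measurableSet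
  have hY' : MeasurableSet ((b / (a + b))⁻¹ • Y) := (hY.smul _).measurableSet
  have hXY : MeasurableSet (X + Y) := (hX.add hY).measurableSet
  have h := prekopa_leindler hp hq hpq
    (f := ((a / (a + b))⁻¹ • X).indicator 1) (g := ((b / (a + b))⁻¹ • Y).indicator 1)
    (h := (X + Y).indicator 1) (measurable_one.indicator hX') (measurable_one.indicator hY')
    (measurable_one.indicator hXY) fun x y => ?_
  · rw [lintegral_indicator_one hX', lintegral_indicator_one hY', lintegral_indicator_one hXY,
      hvol ha hXa, hvol hb hYb, ← ENNReal.rpow_add _ _ (by simp [hab])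
      (ENNReal.pow_ne_top ENNReal.ofReal_ne_top), hpq, ENNReal.rpow_one] at h
    exact h
  · by_cases hx : x ∈ (a / (a + b))⁻¹ • X
    · by_cases hy : y ∈ (b / (a + b))⁻¹ • Y
      · have hz : (a / (a + b)) • x + (b / (a + b)) • y ∈ X + Y :=
          Set.add_mem_add ((Set.mem_inv_smul_set_iff₀ hp.ne' _ _).1 hx)
            ((Set.mem_inv_smul_set_iff₀ hq.ne' _ _).1 hy)
        simp [-inv_div, hx, hy, hz]
      · simp [-inv_div, hy, hq]
    · simp [-inv_div, hx, hp]

theorem lintegral_measure_inter_translate {n : ℕ} {C : Set (Fin n → ℝ)} (hC : MeasurableSet C) :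
    ∫⁻ x, volume {y ∈ C | y - x ∈ C} = volume C ^ 2 := by
  have hm : Measurable fun z : (Fin n → ℝ) × (Fin n → ℝ) =>
      C.indicator (1 : (Fin n → ℝ) → ℝ≥0∞) z.2 * C.indicator 1 (z.2 - z.1) :=
    ((measurable_one.indicator hC).comp measurable_snd).mul
      ((measurable_one.indicator hC).comp (measurable_snd.sub measurable_fst))
  calc ∫⁻ x, volume {y ∈ C | y - x ∈ C}
      = ∫⁻ x, ∫⁻ y, C.indicator (1 : (Fin n → ℝ) → ℝ≥0∞) y * C.indicator 1 (y - x) := by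
        refine lintegral_congr fun x => ?_
        have hs : MeasurableSet {y ∈ C | y - x ∈ C} :=
          hC.inter (hC.preimage (measurable_id.sub_const x))
        rw [← lintegral_indicator_one hs]
        refine lintegral_congr fun y => ?_
        by_cases h1 : y ∈ C <;> by_cases h2 : y - x ∈ C <;> simp [h1, h2]
    _ = ∫⁻ y, ∫⁻ x, C.indicator (1 : (Fin n → ℝ) → ℝ≥0∞) y * C.indicator 1 (y - x) :=
        lintegral_lintegral_swap hm.aemeasurable
    _ = ∫⁻ y, C.indicator (1 : (Fin n → ℝ) → ℝ≥0∞) y * volume C := by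
        refine lintegral_congr fun y => ?_
        rw [lintegral_const_mul (f := fun x => C.indicator (1 : (Fin n → ℝ) → ℝ≥0∞) (y - x)) _
            ((measurable_one.indicator hC).comp (measurable_id.const_sub y)),
          lintegral_sub_left_eq_self (C.indicator (1 : (Fin n → ℝ) → ℝ≥0∞)) y,
          lintegral_indicator_one hC]
    _ = volume C ^ 2 := by
        rw [lintegral_mul_const _ (measurable_one.indicator hC), lintegral_indicator_one hC, sq]

theorem integral_one_sub_pow_mul_pow (n k : ℕ) :
    ∫ t in (0 : ℝ)..1, (1 - t) ^ n * ((k + 1 : ℕ) * t ^ k)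
      = (n.factorial * (k + 1).factorial : ℝ) / (n + (k + 1)).factorial := by
  induction n generalizing k with
  | zero =>
    rw [Nat.factorial_zero, zero_add, Nat.cast_one, one_mul, div_self (by positivity)]
    simp only [pow_zero, one_mul, intervalIntegral.integral_const_mul, integral_pow]
    push_cast
    field_simp
    simp
  | succ n ih =>
    have hderiv : ∀ t ∈ Set.uIcc (0 : ℝ) 1, HasDerivAt (fun t : ℝ => (1 - t) ^ (n + 1) * t ^ (k + 1))
        ((1 - t) ^ (n + 1) * ((k + 1 : ℕ) * t ^ k)
          - (n + 1) / (k + 2) * ((1 - t) ^ n * ((k + 1 + 1 : ℕ) * t ^ (k + 1)))) t := by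
      intro t _
      refine ((((hasDerivAt_id t).const_sub 1).pow (n + 1)).mul
        (hasDerivAt_pow (k + 1) t)).congr_deriv ?_
      simp only [Pi.pow_apply, id, Nat.add_sub_cancel]
      push_cast
      field_simp
      ring
    have h := intervalIntegral.integral_eq_sub_of_hasDerivAt hderiv
      (by apply Continuous.intervalIntegrable; fun_prop)
    rw [intervalIntegral.integral_sub (by apply Continuous.intervalIntegrable; fun_prop)
      (by apply Continuous.intervalIntegrable; fun_prop), intervalIntegral.integral_const_mul,
      ih (k + 1)] at h
    have h' := sub_eq_zero.1 (h.trans (by simp))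
    rw [h', show n + 1 + (k + 1) = n + (k + 1 + 1) by ring, Nat.factorial_succ n,
      Nat.factorial_succ (k + 1)]
    push_cast
    field_simp
    ring

theorem lintegral_one_sub_gauge_pow {n : ℕ} {D : Set (Fin n → ℝ)} (hD : IsCompact D)
    (hconv : Convex ℝ D) (h0 : D ∈ nhds 0) (k : ℕ) :
    ∫⁻ x, ENNReal.ofReal (max (1 - gauge D x) 0 ^ (k + 1))
      = ENNReal.ofReal ((n.factorial * (k + 1).factorial : ℝ) / (n + (k + 1)).factorial)
        * volume D := by
  have hpow : ∀ s : ℝ, ∫ t in (0 : ℝ)..s, ((k + 1 : ℕ) : ℝ) * t ^ k = s ^ (k + 1) := fun s => by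
    rw [intervalIntegral.integral_const_mul, integral_pow]
    push_cast
    field_simp
    simp
  have hlayer := lintegral_comp_eq_lintegral_meas_le_mul_of_measurable
    (f := fun x => max (1 - gauge D x) 0) (g := fun t => ((k + 1 : ℕ) : ℝ) * t ^ k) volume
    (fun x => le_max_right _ _)
    (((continuous_const.sub (continuous_gauge hconv h0)).max continuous_const).measurable)
    (fun t _ => by apply Continuous.intervalIntegrable; fun_prop)
    (by fun_prop) (fun t ht => by positivity)
  simp only [hpow] at hlayer
  have hlevel : ∀ t : ℝ, 0 < t → t < 1 →
      volume {x | t ≤ max (1 - gauge D x) 0} = ENNReal.ofReal ((1 - t) ^ n) * volume D := by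
    intro t ht0 ht1
    have hs : {x | t ≤ max (1 - gauge D x) 0} = (1 - t) • D := by
      ext x
      rw [Set.mem_smul_set_iff_inv_smul_mem₀ (by linarith), ← hD.isClosed.closure_eq,
        ← gauge_le_one_iff_mem_closure hconv h0, gauge_smul_of_nonneg (by simp [ht1.le]),
        smul_eq_mul, hD.isClosed.closure_eq, inv_mul_le_iff₀ (by linarith)]
      simp only [Set.mem_ofPred_eq, le_max_iff, not_le.2 ht0, or_false]
      constructor <;> intro h <;> linarith
    rw [hs, Measure.addHaar_smul, Module.finrank_fin_fun, abs_of_nonneg (by bound)]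
  have hint : Integrable (fun t : ℝ => (1 - t) ^ n * ((k + 1 : ℕ) * t ^ k))
      (volume.restrict (Set.Ioc 0 1)) :=
    (intervalIntegrable_iff_integrableOn_Ioc_of_le zero_le_one).1
      (by apply Continuous.intervalIntegrable; fun_prop)
  have hnn : 0 ≤ᵐ[volume.restrict (Set.Ioc (0 : ℝ) 1)]
      fun t : ℝ => (1 - t) ^ n * ((k + 1 : ℕ) * t ^ k) := by
    refine (ae_restrict_iff' measurableSet_Ioc).2 (Filter.Eventually.of_forall fun t ht => ?_)
    have h1 : 0 ≤ 1 - t := by linarith [ht.2]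
    have h2 : 0 ≤ t := ht.1.le
    simp only [Pi.zero_apply]
    positivity
  rw [hlayer, ← integral_one_sub_pow_mul_pow, intervalIntegral.integral_of_le zero_le_one,
    ofReal_integral_eq_lintegral_ofReal hint hnn,
    ← lintegral_mul_const' _ _ hD.measure_lt_top.ne,
    ← lintegral_indicator measurableSet_Ioi, ← lintegral_indicator measurableSet_Ioc]
  have hne : ∀ᵐ t : ℝ, t ≠ 1 := by simp [ae_iff]
  refine lintegral_congr_ae (hne.mono fun t ht => ?_)
  by_cases ht0 : 0 < t
  · rcases lt_or_gt_of_ne ht with ht1 | ht1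
    · have h1 : 0 ≤ 1 - t := by linarith
      simp only [Set.indicator, Set.mem_Ioi, Set.mem_Ioc, ht0, ht1.le, and_self, if_true]
      rw [hlevel t ht0 ht1, ENNReal.ofReal_mul (pow_nonneg h1 n), mul_right_comm]
    · have hs : {x | t ≤ max (1 - gauge D x) 0} = ∅ := by
        ext x
        have := gauge_nonneg (s := D) x
        simp only [Set.mem_ofPred_eq, Set.mem_empty_iff_false, iff_false, not_le]
        exact max_lt (by linarith) ht0
      simp only [Set.indicator, Set.mem_Ioi, Set.mem_Ioc, ht0, ht1.not_ge, and_false, if_true,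
        if_false, hs, measure_empty, zero_mul]
  · simp [Set.indicator, ht0]

theorem IsCompact.sub_self_set {n : ℕ} {A : Set (Fin n → ℝ)} (hA : IsCompact A) :
    IsCompact (A - A) :=
  sub_eq_add_neg A A ▸ hA.add hA.neg

theorem mem_gauge_smul {n : ℕ} {D : Set (Fin n → ℝ)} (hD : IsCompact D) (hconv : Convex ℝ D)
    (h0 : D ∈ nhds 0) (x : Fin n → ℝ) : x ∈ gauge D x • D := by
  rcases (gauge_nonneg (s := D) x).eq_or_lt with hr | hr
  · have hx : x = 0 := (gauge_eq_zero (absorbent_nhds_zero h0)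
      (NormedSpace.isVonNBounded_of_isBounded ℝ hD.isBounded)).1 hr.symm
    rw [← hr, hx]
    exact ⟨0, mem_of_mem_nhds h0, smul_zero _⟩
  · have h := (gauge_le_one_iff_mem_closure hconv h0 (x := (gauge D x)⁻¹ • x)).1 (by
      rw [gauge_smul_of_nonneg (inv_nonneg.2 hr.le), smul_eq_mul, inv_mul_cancel₀ hr.ne'])
    rwa [hD.isClosed.closure_eq, ← Set.mem_smul_set_iff_inv_smul_mem₀ hr.ne'] at h

theorem le_measure_inter_translate {n : ℕ} {A B : Set (Fin n → ℝ)} (hA : IsCompact A)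
    (hAconv : Convex ℝ A) (hB : IsCompact B) (hD : A - A ∈ nhds 0) {a b : ℝ} (ha : 0 < a)
    (hb : 0 < b) (hAa : volume A = ENNReal.ofReal a ^ n) (hBb : volume B = ENNReal.ofReal b ^ n)
    {x : Fin n → ℝ} (hx : gauge (A - A) x < 1) :
    ENNReal.ofReal ((1 - gauge (A - A) x) * a + b) ^ n
      ≤ volume {y ∈ A + B | y - x ∈ A + B} := by
  have hmem := mem_gauge_smul hA.sub_self_set (hAconv.sub hAconv) hD x
  have hr0 : 0 ≤ gauge (A - A) x := gauge_nonneg x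
  generalize gauge (A - A) x = r at *
  have hm : 0 < 1 - r := sub_pos.2 hx
  obtain ⟨_, ⟨u, hu, v, hv, rfl⟩, rfl⟩ := hmem
  have hscaled : volume ((1 - r) • A) = ENNReal.ofReal ((1 - r) * a) ^ n := by
    rw [Measure.addHaar_smul, hAa, Module.finrank_fin_fun, abs_of_pos (by positivity),
      ENNReal.ofReal_pow hm.le, ← mul_pow, ← ENNReal.ofReal_mul hm.le]
  have hBM := brunn_minkowski (hA.smul (1 - r)) hB (mul_pos hm ha) hb hscaled hBb
  refine hBM.trans ?_
  rw [← measure_preimage_add volume (-(r • u)), ← Set.image_add_left]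
  refine measure_mono ?_
  have hcomb : ∀ w ∈ A, ∀ z ∈ A, r • w + (1 - r) • z ∈ A := fun w hw z hz =>
    hAconv hw hz hr0 hm.le (by ring)
  rintro _ ⟨_, ⟨_, ⟨z, hz, rfl⟩, c, hc, rfl⟩, rfl⟩
  constructor
  · exact ⟨_, hcomb u hu z hz, c, hc, by simp only; abel⟩
  · exact ⟨_, hcomb v hv z hz, c, hc, by simp only [smul_sub]; abel⟩

theorem sub_self_mem_nhds_zero {n : ℕ} {A : Set (Fin n → ℝ)} (hAconv : Convex ℝ A)
    (hA0 : 0 < volume A) : A - A ∈ nhds 0 := by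
  have hint : (interior A).Nonempty := by
    by_contra h
    rw [Set.not_nonempty_iff_eq_empty] at h
    refine hA0.ne' (measure_mono_null ?_ (hAconv.addHaar_frontier volume))
    rw [frontier, h, Set.sdiff_empty]
    exact subset_closure
  obtain ⟨z, hz⟩ := hint
  refine Filter.mem_of_superset ((isOpen_interior.sub_right (t := A)).mem_nhds
    ⟨z, hz, z, interior_subset hz, sub_self z⟩) (Set.sub_subset_sub_right interior_subset)

theorem sum_le_measure_add_sq {n : ℕ} {A B : Set (Fin n → ℝ)} (hA : IsCompact A)
    (hAconv : Convex ℝ A) (hA0 : 0 < volume A) (hB : IsCompact B) {a b : ℝ} (ha : 0 < a)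
    (hb : 0 < b) (hAa : volume A = ENNReal.ofReal a ^ n)
    (hBb : volume B = ENNReal.ofReal b ^ n) :
    ∑ k ∈ Finset.Icc 1 n, ENNReal.ofReal (n.choose k * a ^ k * b ^ (n - k)) *
        (ENNReal.ofReal ((n.factorial * k.factorial : ℝ) / (n + k).factorial) * volume (A - A))
      ≤ volume (A + B) ^ 2 := by
  have hD := sub_self_mem_nhds_zero hAconv hA0
  have hDc : IsCompact (A - A) := hA.sub_self_set
  have hDconv : Convex ℝ (A - A) := hAconv.sub hAconv
  have hmeas : Measurable fun x => max (1 - gauge (A - A) x) 0 :=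
    ((continuous_const.sub (continuous_gauge hDconv hD)).max continuous_const).measurable
  rw [← lintegral_measure_inter_translate (hA.add hB).measurableSet]
  calc _ = ∑ k ∈ Finset.Icc 1 n, ENNReal.ofReal (n.choose k * a ^ k * b ^ (n - k)) *
        ∫⁻ x, ENNReal.ofReal (max (1 - gauge (A - A) x) 0 ^ k) := by
        refine Finset.sum_congr rfl fun k hk => ?_
        obtain ⟨j, rfl⟩ : ∃ j, k = j + 1 := ⟨k - 1, by have := (Finset.mem_Icc.1 hk).1; omega⟩
        rw [lintegral_one_sub_gauge_pow hDc hDconv hD]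
    _ = ∫⁻ x, ∑ k ∈ Finset.Icc 1 n, ENNReal.ofReal (n.choose k * a ^ k * b ^ (n - k)) *
        ENNReal.ofReal (max (1 - gauge (A - A) x) 0 ^ k) := by
        rw [lintegral_finsetSum _ fun k _ => (hmeas.pow_const k).ennreal_ofReal.const_mul _]
        exact Finset.sum_congr rfl fun k _ =>
          (lintegral_const_mul _ (hmeas.pow_const k).ennreal_ofReal).symm
    _ ≤ _ := lintegral_mono fun x => ?_
  rcases lt_or_ge (gauge (A - A) x) 1 with hx | hx
  · have hm : 0 < 1 - gauge (A - A) x := sub_pos.2 hx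
    refine le_trans ?_ (le_measure_inter_translate hA hAconv hB hD ha hb hAa hBb hx)
    simp only [max_eq_left hm.le]
    generalize 1 - gauge (A - A) x = m at hm
    have hnn : ∀ k ∈ Finset.Icc 1 n, 0 ≤ (m * a) ^ k * b ^ (n - k) * n.choose k :=
      fun k _ => by positivity
    calc _ = ENNReal.ofReal (∑ k ∈ Finset.Icc 1 n, (m * a) ^ k * b ^ (n - k) * n.choose k) := by
          rw [ENNReal.ofReal_sum_of_nonneg hnn]
          refine Finset.sum_congr rfl fun k _ => ?_
          rw [← ENNReal.ofReal_mul (by positivity)]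
          congr 1
          ring
      _ ≤ ENNReal.ofReal ((m * a + b) ^ n) := by
          rw [add_pow]
          refine ENNReal.ofReal_le_ofReal
            (Finset.sum_le_sum_of_subset_of_nonneg (fun k hk => ?_) fun k _ _ => by positivity)
          exact Finset.mem_range.2 (Nat.lt_succ_of_le (Finset.mem_Icc.1 hk).2)
      _ = _ := ENNReal.ofReal_pow (by positivity) n
  · rw [Finset.sum_eq_zero fun k hk => ?_]
    · exact zero_le
    · rw [max_eq_right (by linarith), zero_pow (by have := (Finset.mem_Icc.1 hk).1; omega)]
      simp

theorem exists_measure_eq_ofReal_pow {n : ℕ} (hn : n ≠ 0) {X : Set (Fin n → ℝ)}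
    (hX : IsCompact X) (hX0 : 0 < volume X) :
    ∃ a : ℝ, 0 < a ∧ volume X = ENNReal.ofReal a ^ n := by
  have h0 : 0 < (volume X).toReal := ENNReal.toReal_pos hX0.ne' hX.measure_lt_top.ne
  refine ⟨(volume X).toReal ^ (n : ℝ)⁻¹, by positivity, ?_⟩
  rw [← ENNReal.ofReal_pow (by positivity), Real.rpow_inv_natCast_pow h0.le hn,
    ENNReal.ofReal_toReal hX.measure_lt_top.ne]

theorem sumset_sq_ge_sum {n : ℕ} (A B : Set (Fin n → ℝ))
    (hA : IsCompact A) (hAconv : Convex ℝ A) (hA0 : 0 < volume A)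
    (hB : IsCompact B) (hBne : B.Nonempty) :
    (volume B).toReal * (volume (A - A)).toReal *
      ∑ k ∈ Finset.Icc 1 n,
        ((volume B).toReal / (volume A).toReal) ^ (-(k : ℝ) / n) *
          ((n.factorial : ℝ) ^ 2 / ((n - k).factorial * (n + k).factorial))
      ≤ (volume (A + B)).toReal ^ 2 := by
  rcases eq_or_ne n 0 with rfl | hn
  · simp
  rcases eq_or_ne (volume B) 0 with hB0 | hB0
  · simp [hB0]
  obtain ⟨a, ha, hAa⟩ := exists_measure_eq_ofReal_pow hn hA hA0
  obtain ⟨b, hb, hBb⟩ := exists_measure_eq_ofReal_pow hn hB (pos_iff_ne_zero.2 hB0)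
  have h := ENNReal.toReal_mono (ENNReal.pow_ne_top (hA.add hB).measure_lt_top.ne)
    (sum_le_measure_add_sq hA hAconv hA0 hB ha hb hAa hBb)
  rw [ENNReal.toReal_pow, ENNReal.toReal_sum fun k _ => ENNReal.mul_ne_top ENNReal.ofReal_ne_top
    (ENNReal.mul_ne_top ENNReal.ofReal_ne_top (hA.sub_self_set).measure_lt_top.ne)] at h
  refine le_trans (le_of_eq ?_) h
  rw [Finset.mul_sum]
  refine Finset.sum_congr rfl fun k hk => ?_
  obtain ⟨hk1, hkn⟩ := Finset.mem_Icc.1 hk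
  rw [ENNReal.toReal_mul, ENNReal.toReal_mul, ENNReal.toReal_ofReal (by positivity),
    ENNReal.toReal_ofReal (by positivity), hAa, hBb, ENNReal.toReal_pow, ENNReal.toReal_pow,
    ENNReal.toReal_ofReal ha.le, ENNReal.toReal_ofReal hb.le, ← div_pow,
    ← Real.rpow_natCast_mul (by positivity), mul_div_cancel₀ _ (by positivity),
    Real.rpow_neg (by positivity), Real.rpow_natCast, Nat.cast_choose ℝ hkn,
    div_pow, show b ^ n = b ^ (n - k) * b ^ k by rw [← pow_add, Nat.sub_add_cancel hkn]]
  field_simp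
end

section
/- There exists an absolute constant $C > 0$ (independent of $n$) such that the following holds. Let $A \subseteq \mathbb{R}^n$ be a compact convex set and $B \subseteq \mathbb{R}^n$ a compact set with $\mu(A) \ge \mu(B) > 0$. Then $\mu(A - A) \le C\, \frac{\mu(A+B)^2}{\sqrt{n}\, \mu(A)^{1/n}\, \mu(B)^{1 - 1/n}}$. -/
open MeasureTheory Pointwise

theorem Real.volume_add_le_volume_add_of_isCompact {K L : Set ℝ} (hK : IsCompact K)
    (hL : IsCompact L) (hK' : K.Nonempty) (hL' : L.Nonempty) :
    volume K + volume L ≤ volume (K + L) := by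
  obtain ⟨a, ha, haK⟩ := hK.exists_isGreatest hK'
  obtain ⟨b, hb, hbL⟩ := hL.exists_isLeast hL'
  have h1 : volume ((fun x => x + b) '' K) = volume K := by
    simp [Set.image_add_right]
  have h2 : volume ((fun x => a + x) '' L) = volume L := by
    simp [Set.image_add_left]
  have hm : MeasurableSet ((fun x => a + x) '' L) :=
    (hL.image (by fun_prop)).measurableSet
  have hd : AEDisjoint volume ((fun x => x + b) '' K) ((fun x => a + x) '' L) := by
    refine measure_mono_null (t := {a + b}) ?_ (by simp)
    rintro _ ⟨⟨x, hx, rfl⟩, y, hy, hxy⟩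
    have := haK hx
    have := hbL hy
    simp only [Set.mem_singleton_iff] at *
    linarith
  rw [← h1, ← h2, ← measure_union₀ hm.nullMeasurableSet hd]
  refine measure_mono (Set.union_subset ?_ ?_)
  · rintro _ ⟨x, hx, rfl⟩
    exact Set.add_mem_add hx hb
  · rintro _ ⟨x, hx, rfl⟩
    exact Set.add_mem_add ha hx

theorem Real.volume_add_volume_le_of_add_subset {U V W : Set ℝ} (hU : MeasurableSet U)
    (hV : MeasurableSet V) (hU' : U.Nonempty) (hV' : V.Nonempty) (hW : U + V ⊆ W) :
    volume U + volume V ≤ volume W := by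
  obtain ⟨u, hu⟩ := hU'
  obtain ⟨v, hv⟩ := hV'
  rw [hU.measure_eq_iSup_isCompact, hV.measure_eq_iSup_isCompact]
  simp only [iSup_and']
  refine ENNReal.biSup_add_biSup_le' ⟨∅, by simp⟩ ⟨∅, by simp⟩ ?_
  rintro K ⟨hKU, hK⟩ L ⟨hLV, hL⟩
  calc volume K + volume L ≤ volume (insert u K) + volume (insert v L) := by
        gcongr <;> exact Set.subset_insert _ _
    _ ≤ volume (insert u K + insert v L) :=
        Real.volume_add_le_volume_add_of_isCompact (hK.insert u) (hL.insert v)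
          (Set.insert_nonempty _ _) (Set.insert_nonempty _ _)
    _ ≤ volume W := measure_mono <| (Set.add_subset_add
        (Set.insert_subset hu hKU) (Set.insert_subset hv hLV)).trans hW

theorem lintegral_add_lintegral_le_of_superlevel {f g h : ℝ → ℝ} (hf : Measurable f)
    (hg : Measurable g) (hh : Measurable h) (hf0 : 0 ≤ f) (hg0 : 0 ≤ g) (hh0 : 0 ≤ h)
    (hf1 : ∀ x, f x ≤ 1) (hg1 : ∀ x, g x ≤ 1)
    (hf2 : ∀ s < 1, ∃ x, s < f x) (hg2 : ∀ s < 1, ∃ x, s < g x)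
    (hfg : ∀ s, 0 < s → s < 1 → ∀ x y, s < f x → s < g y → s ≤ h (x + y)) :
    (∫⁻ x, ENNReal.ofReal (f x)) + ∫⁻ x, ENNReal.ofReal (g x)
      ≤ ∫⁻ x, ENNReal.ofReal (h x) := by
  rw [lintegral_eq_lintegral_meas_lt volume (.of_forall hf0) hf.aemeasurable,
    lintegral_eq_lintegral_meas_lt volume (.of_forall hg0) hg.aemeasurable,
    lintegral_eq_lintegral_meas_le volume (.of_forall hh0) hh.aemeasurable,
    ← lintegral_add_left (μ := volume.restrict (Set.Ioi 0)) (f := fun t => volume {a | t < f a})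
      (Antitone.measurable fun s t hst => measure_mono fun x hx => lt_of_le_of_lt hst hx)]
  refine setLIntegral_mono' measurableSet_Ioi fun s hs => ?_
  rcases lt_or_ge s 1 with h1 | h1
  · refine Real.volume_add_volume_le_of_add_subset (hf measurableSet_Ioi)
      (hg measurableSet_Ioi) (hf2 s h1) (hg2 s h1) ?_
    rintro _ ⟨x, hx, y, hy, rfl⟩
    exact hfg s hs h1 x y hx hy
  · have e1 : {x | s < f x} = ∅ := by
      ext x; simpa using (hf1 x).trans h1
    have e2 : {x | s < g x} = ∅ := by
      ext x; simpa using (hg1 x).trans h1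
    simp [e1, e2]

theorem add_pow_succ_le_mul_div_add_div {a b p q : ℝ} (n : ℕ) (ha : 0 ≤ a) (hb : 0 ≤ b)
    (hp : 0 < p) (hq : 0 < q) :
    (a + b) ^ (n + 1) ≤ (p + q) ^ n * (a ^ (n + 1) / p ^ n + b ^ (n + 1) / q ^ n) := by
  have hpq : 0 < p + q := by positivity
  have := (convexOn_pow (n + 1)).2 (Set.mem_Ici.2 (show 0 ≤ a / p by positivity))
    (Set.mem_Ici.2 (show 0 ≤ b / q by positivity)) (show 0 ≤ p / (p + q) by positivity)
    (show 0 ≤ q / (p + q) by positivity) (by field_simp)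
  simp only [smul_eq_mul] at this
  have e : p / (p + q) * (a / p) + q / (p + q) * (b / q) = (a + b) / (p + q) := by
    field_simp
  rw [e, div_pow, div_le_iff₀ (by positivity)] at this
  refine this.trans_eq ?_
  simp only [div_pow, pow_succ]
  field_simp

/-- The inductive step of the Brunn-Minkowski inequality: from `ℝⁿ` to `ℝ × ℝⁿ`. -/
theorem brunnMinkowski_prod {n : ℕ} (hn : n ≠ 0)
    (ih : ∀ A B : Set (Fin n → ℝ), IsCompact A → IsCompact B → ∀ a b : ℝ, 0 < a → 0 < b →
      ENNReal.ofReal (a ^ n) ≤ volume A → ENNReal.ofReal (b ^ n) ≤ volume B →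
      ENNReal.ofReal ((a + b) ^ n) ≤ volume (A + B))
    {A B : Set (ℝ × (Fin n → ℝ))} (hA : IsCompact A) (hB : IsCompact B) {a b : ℝ}
    (ha : 0 < a) (hb : 0 < b) (hAa : ENNReal.ofReal (a ^ (n + 1)) ≤ volume A)
    (hBb : ENNReal.ofReal (b ^ (n + 1)) ≤ volume B) :
    ENNReal.ofReal ((a + b) ^ (n + 1)) ≤ volume (A + B) := by
  have fin : ∀ {S : Set (ℝ × (Fin n → ℝ))}, IsCompact S → ∀ x,
      volume (Prod.mk x ⁻¹' S) ≤ volume (Prod.snd '' S) := fun _ x =>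
    measure_mono fun y hy => ⟨(x, y), hy, rfl⟩
  have fin' : ∀ {S : Set (ℝ × (Fin n → ℝ))}, IsCompact S → volume (Prod.snd '' S) < ⊤ :=
    fun hS => (hS.image continuous_snd).measure_lt_top
  have meas : ∀ {S : Set (ℝ × (Fin n → ℝ))}, IsCompact S →
      Measurable fun x => (volume (Prod.mk x ⁻¹' S)).toReal := fun hS =>
    (measurable_measure_prodMk_left hS.measurableSet).ennreal_toReal
  have slice : ∀ {S : Set (ℝ × (Fin n → ℝ))}, IsCompact S → ∀ x, IsCompact (Prod.mk x ⁻¹' S) :=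
    fun hS x => (Topology.IsClosedEmbedding.isCompact_preimage
      (Topology.IsClosedEmbedding.of_continuous_injective_isClosedMap (by fun_prop)
        (Prod.mk_right_injective x) (isClosedMap_prodMk_left x)) hS)
  have prodV : ∀ {S : Set (ℝ × (Fin n → ℝ))}, IsCompact S → ∀ c : ℝ, 0 < c →
      (∫⁻ x, ENNReal.ofReal ((volume (Prod.mk x ⁻¹' S)).toReal / c))
        = volume S / ENNReal.ofReal c := by
    intro S hS c hc
    rw [Measure.volume_eq_prod, Measure.prod_apply hS.measurableSet, ENNReal.div_eq_inv_mul,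
      ← lintegral_const_mul _ (measurable_measure_prodMk_left hS.measurableSet)]
    refine lintegral_congr fun x => ?_
    rw [ENNReal.ofReal_div_of_pos hc, ENNReal.ofReal_toReal ((fin hS x).trans_lt (fin' hS)).ne,
      ENNReal.div_eq_inv_mul]
  have root : ∀ {S : Set (ℝ × (Fin n → ℝ))}, IsCompact S → 0 < volume S →
      ∃ p : ℝ, 0 < p ∧ (∀ x, (volume (Prod.mk x ⁻¹' S)).toReal / p ^ n ≤ 1) ∧
        ∀ s < 1, ∃ x, s < (volume (Prod.mk x ⁻¹' S)).toReal / p ^ n := by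
    intro S hS hpos
    set F : ℝ → ℝ := fun x => (volume (Prod.mk x ⁻¹' S)).toReal with hF
    have bdd : BddAbove (Set.range F) := ⟨_, by
      rintro _ ⟨x, rfl⟩
      exact ENNReal.toReal_mono (fin' hS).ne (fin hS x)⟩
    have hM : 0 < ⨆ x, F x := by
      by_contra! hle
      have h0 : ∀ x, F x = 0 := fun x =>
        le_antisymm ((le_ciSup bdd x).trans hle) ENNReal.toReal_nonneg
      have := prodV hS 1 one_pos
      simp only [show ∀ x, (volume (Prod.mk x ⁻¹' S)).toReal = 0 from h0] at this
      simp at this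
      exact hpos.ne this
    refine ⟨(⨆ x, F x) ^ ((n : ℝ)⁻¹), by positivity, ?_⟩
    rw [Real.rpow_inv_natCast_pow hM.le hn]
    refine ⟨fun x => (div_le_one hM).2 (le_ciSup bdd x), fun s hs => ?_⟩
    obtain ⟨x, hx⟩ := exists_lt_of_lt_ciSup (show s * (⨆ x, F x) < ⨆ x, F x by nlinarith)
    exact ⟨x, (lt_div_iff₀ hM).2 hx⟩
  have hC : IsCompact (A + B) := hA.add hB
  obtain ⟨p, hp, hp1, hp2⟩ := root hA (lt_of_lt_of_le (ENNReal.ofReal_pos.2 (by positivity)) hAa)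
  obtain ⟨q, hq, hq1, hq2⟩ := root hB (lt_of_lt_of_le (ENNReal.ofReal_pos.2 (by positivity)) hBb)
  have key := lintegral_add_lintegral_le_of_superlevel ((meas hA).div_const (p ^ n))
    ((meas hB).div_const (q ^ n)) ((meas hC).div_const ((p + q) ^ n))
    (fun x => by positivity) (fun x => by positivity) (fun x => by positivity)
    hp1 hq1 hp2 hq2 ?_
  · rw [prodV hA _ (by positivity), prodV hB _ (by positivity), prodV hC _ (by positivity),
      ENNReal.le_div_iff_mul_le (.inl (ENNReal.ofReal_pos.2 (by positivity)).ne')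
        (.inl ENNReal.ofReal_ne_top)] at key
    refine le_trans ?_ key
    calc ENNReal.ofReal ((a + b) ^ (n + 1))
        ≤ ENNReal.ofReal ((p + q) ^ n * (a ^ (n + 1) / p ^ n + b ^ (n + 1) / q ^ n)) :=
          ENNReal.ofReal_le_ofReal (add_pow_succ_le_mul_div_add_div n ha.le hb.le hp hq)
      _ = (ENNReal.ofReal (a ^ (n + 1)) / ENNReal.ofReal (p ^ n)
            + ENNReal.ofReal (b ^ (n + 1)) / ENNReal.ofReal (q ^ n))
            * ENNReal.ofReal ((p + q) ^ n) := by
          rw [mul_comm, ENNReal.ofReal_mul (by positivity),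
            ENNReal.ofReal_add (by positivity) (by positivity),
            ENNReal.ofReal_div_of_pos (by positivity), ENNReal.ofReal_div_of_pos (by positivity)]
      _ ≤ _ := by gcongr
  · intro s hs0 hs1 x y hx hy
    rw [lt_div_iff₀ (by positivity)] at hx hy
    rw [le_div_iff₀ (by positivity)]
    obtain ⟨r, hr, rfl⟩ : ∃ r : ℝ, 0 < r ∧ r ^ n = s :=
      ⟨s ^ ((n : ℝ)⁻¹), by positivity, Real.rpow_inv_natCast_pow hs0.le hn⟩
    have := ih _ _ (slice hA x) (slice hB y) (r * p) (r * q) (by positivity) (by positivity)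
      (by rw [mul_pow]; exact ENNReal.ofReal_le_of_le_toReal hx.le)
      (by rw [mul_pow]; exact ENNReal.ofReal_le_of_le_toReal hy.le)
    rw [← mul_pow, mul_add]
    refine (ENNReal.ofReal_le_iff_le_toReal ((fin hC _).trans_lt (fin' hC)).ne).1
      (this.trans (measure_mono ?_))
    rintro _ ⟨u, hu, v, hv, rfl⟩
    exact ⟨(x, u), hu, (y, v), hv, rfl⟩

/-- The Brunn-Minkowski inequality in `ℝⁿ` for compact sets of positive measure, stated without
roots. -/
theorem brunnMinkowski {n : ℕ} (hn : 1 ≤ n) :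
    ∀ A B : Set (Fin n → ℝ), IsCompact A → IsCompact B → ∀ a b : ℝ, 0 < a → 0 < b →
      ENNReal.ofReal (a ^ n) ≤ volume A → ENNReal.ofReal (b ^ n) ≤ volume B →
      ENNReal.ofReal ((a + b) ^ n) ≤ volume (A + B) := by
  induction n, hn using Nat.le_induction with
  | base =>
    intro A B hA hB a b ha hb hAa hBb
    have mp := volume_preserving_funUnique (Fin 1) ℝ
    have tr : ∀ S : Set (Fin 1 → ℝ), volume S = volume ((fun f => f 0) '' S) := fun S => by
      rw [← mp.measure_preimage_equiv]
      congr 1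
      exact (Set.preimage_image_eq S (MeasurableEquiv.funUnique (Fin 1) ℝ).injective).symm
    have cont : Continuous fun f : Fin 1 → ℝ => f 0 := continuous_apply 0
    have ne : ∀ {S : Set (Fin 1 → ℝ)} {c : ℝ}, 0 < c → ENNReal.ofReal (c ^ 1) ≤ volume S →
        S.Nonempty := fun hc h =>
      nonempty_of_measure_ne_zero (lt_of_lt_of_le (by simpa) h).ne'
    rw [pow_one, ENNReal.ofReal_add ha.le hb.le]
    calc _ ≤ volume A + volume B := by simpa using add_le_add hAa hBb
      _ ≤ volume ((fun f : Fin 1 → ℝ => f 0) '' A + (fun f : Fin 1 → ℝ => f 0) '' B) := by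
        rw [tr A, tr B]
        exact Real.volume_add_le_volume_add_of_isCompact (hA.image cont) (hB.image cont)
          ((ne ha hAa).image _) ((ne hb hBb).image _)
      _ = volume (A + B) := by
        rw [tr (A + B)]
        exact congrArg volume (Set.image_add (Pi.evalAddMonoidHom (fun _ : Fin 1 => ℝ) 0)).symm
  | succ n hn ih =>
    intro A B hA hB a b ha hb hAa hBb
    have mp := volume_preserving_piFinSuccAbove (fun _ : Fin (n + 1) => ℝ) 0
    set e : (Fin (n + 1) → ℝ) → ℝ × (Fin n → ℝ) := fun f => (f 0, fun i => f i.succ) with he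
    have hee : ⇑(MeasurableEquiv.piFinSuccAbove (fun _ : Fin (n + 1) => ℝ) 0) = e := by
      ext f <;> simp [e, MeasurableEquiv.piFinSuccAbove, Fin.tail]
    have tr : ∀ S : Set (Fin (n + 1) → ℝ), volume S = volume (e '' S) := fun S => by
      rw [← mp.measure_preimage_equiv, ← hee,
        Set.preimage_image_eq S (MeasurableEquiv.injective _)]
    have cont : Continuous e := by fun_prop
    have hadd : e '' (A + B) = e '' A + e '' B := by
      refine Set.image_image2_distrib fun x y => ?_
      ext <;> simp [e]
    rw [tr] at hAa hBb ⊢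
    rw [hadd]
    exact brunnMinkowski_prod (by omega) ih (hA.image cont) (hB.image cont) ha hb hAa hBb

theorem volume_sq_eq_lintegral_inter {n : ℕ} {X : Set (Fin n → ℝ)} (hX : MeasurableSet X) :
    volume X ^ 2 = ∫⁻ d : Fin n → ℝ, volume {x | x ∈ X ∧ x - d ∈ X} := by
  have hS : MeasurableSet {z : (Fin n → ℝ) × (Fin n → ℝ) | z.2 ∈ X ∧ z.2 - z.1 ∈ X} :=
    (measurable_snd hX).inter ((measurable_snd.sub measurable_fst) hX)
  have h1 := Measure.prod_apply (μ := volume) (ν := volume) hS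
  have h2 := Measure.prod_apply_symm (μ := volume) (ν := volume) hS
  have h3 : ∀ x : Fin n → ℝ,
      volume ((fun d => (d, x)) ⁻¹' {z : (Fin n → ℝ) × (Fin n → ℝ) | z.2 ∈ X ∧ z.2 - z.1 ∈ X})
        = X.indicator (fun _ => volume X) x := by
    intro x
    by_cases hx : x ∈ X
    · simp only [Set.preimage_ofPred_eq, hx, true_and, Set.indicator_of_mem]
      exact (Measure.measurePreserving_sub_left volume x).measure_preimage hX.nullMeasurableSet
    · simp [hx]
  rw [h1] at h2
  simp only [h3, lintegral_indicator hX, lintegral_const, Measure.restrict_apply_univ] at h2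
  rw [sq, ← h2]
  rfl

theorem le_volume_inter_translate {n : ℕ} (hn : 1 ≤ n) {A B : Set (Fin n → ℝ)}
    (hA : IsCompact A) (hAc : Convex ℝ A) (hB : IsCompact B) {a b : ℝ} (ha : 0 < a) (hb : 0 < b)
    (hAa : ENNReal.ofReal (a ^ n) ≤ volume A) (hBb : ENNReal.ofReal (b ^ n) ≤ volume B)
    {t : ℝ} (ht0 : 0 ≤ t) (ht1 : t ≤ 1) {d : Fin n → ℝ} (hd : d ∈ (1 - t) • (A - A)) :
    ENNReal.ofReal ((t * a + b) ^ n) ≤ volume {x | x ∈ A + B ∧ x - d ∈ A + B} := by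
  obtain ⟨_, ⟨u, hu, v, hv, rfl⟩, rfl⟩ := hd
  have sub : t • A + B ⊆
      (fun x => (1 - t) • u + x) ⁻¹' {x | x ∈ A + B ∧ x - (1 - t) • (u - v) ∈ A + B} := by
    rintro _ ⟨_, ⟨x, hx, rfl⟩, y, hy, rfl⟩
    refine ⟨⟨(1 - t) • u + t • x, hAc hu hx (by linarith) ht0 (by ring), y, hy, ?_⟩,
      (1 - t) • v + t • x, hAc hv hx (by linarith) ht0 (by ring), y, hy, ?_⟩
    · simp only; abel
    · simp only [smul_sub]; abel
  have le : volume (t • A + B) ≤ volume {x | x ∈ A + B ∧ x - (1 - t) • (u - v) ∈ A + B} :=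
    (measure_mono sub).trans_eq (measure_preimage_add _ _ _)
  refine le_trans ?_ le
  rcases ht0.eq_or_lt with rfl | ht
  · rw [Set.zero_smul_set ⟨u, hu⟩, zero_add, zero_mul, zero_add]
    exact hBb
  · refine brunnMinkowski hn _ _ (hA.smul t) hB _ _ (by positivity) hb ?_ hBb
    rw [Measure.addHaar_smul, abs_of_nonneg (by positivity), Module.finrank_fin_fun, mul_pow,
      ENNReal.ofReal_mul (by positivity)]
    gcongr

theorem lintegral_deriv_le_of_isCompact {n : ℕ} {a b : ℝ} (ha : 0 < a) (hb : 0 < b) {S : Set ℝ}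
    (hS : IsCompact S) (hS0 : ∀ t ∈ S, 0 ≤ t) {v : ENNReal}
    (hv : ∀ t ∈ S, ENNReal.ofReal ((t * a + b) ^ n) ≤ v) :
    ∫⁻ t in S, ENNReal.ofReal (n * a * (t * a + b) ^ (n - 1)) ≤ v := by
  rcases S.eq_empty_or_nonempty with rfl | hne
  · simp
  obtain ⟨T, hT, hST⟩ := hS.exists_isGreatest hne
  have hT0 := hS0 T hT
  have nonneg : ∀ t ∈ Set.Icc 0 T, 0 ≤ n * a * (t * a + b) ^ (n - 1) := fun t ht => by
    have := ht.1
    positivity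
  have cont : Continuous fun t : ℝ => n * a * (t * a + b) ^ (n - 1) := by fun_prop
  have ftc : ∫ t in (0 : ℝ)..T, n * a * (t * a + b) ^ (n - 1) = (T * a + b) ^ n - (0 * a + b) ^ n :=
    intervalIntegral.integral_eq_sub_of_hasDerivAt (f := fun t => (t * a + b) ^ n)
      (fun t _ => by
        have := (((hasDerivAt_id t).mul_const a).add_const b).pow n
        refine this.congr_deriv ?_
        simp only [id]
        ring) (cont.intervalIntegrable _ _)
  calc ∫⁻ t in S, ENNReal.ofReal (n * a * (t * a + b) ^ (n - 1))
      ≤ ∫⁻ t in Set.Icc 0 T, ENNReal.ofReal (n * a * (t * a + b) ^ (n - 1)) :=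
        lintegral_mono_set fun t ht => ⟨hS0 t ht, hST ht⟩
    _ = ENNReal.ofReal ((T * a + b) ^ n - (0 * a + b) ^ n) := by
        rw [← ftc, intervalIntegral.integral_of_le hT0, ← integral_Icc_eq_integral_Ioc,
          ofReal_integral_eq_lintegral_ofReal cont.integrableOn_Icc
            (ae_restrict_of_forall_mem measurableSet_Icc nonneg)]
    _ ≤ ENNReal.ofReal ((T * a + b) ^ n) :=
        ENNReal.ofReal_le_ofReal (sub_le_self _ (by positivity))
    _ ≤ v := hv T hT

theorem isCompact_dilation_graph {E : Type*} [AddCommGroup E] [Module ℝ E] [TopologicalSpace E]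
    [ContinuousSMul ℝ E] {K : Set E} (hK : IsCompact K) :
    IsCompact {z : E × ℝ | z.2 ∈ Set.Icc (0 : ℝ) 1 ∧ z.1 ∈ (1 - z.2) • K} := by
  convert (isCompact_Icc (a := (0 : ℝ)) (b := 1)).prod hK |>.image
    (f := fun p : ℝ × E => ((1 - p.1) • p.2, p.1)) (by fun_prop) using 1
  ext ⟨d, t⟩
  constructor
  · rintro ⟨ht, k, hk, h⟩
    exact ⟨(t, k), ⟨ht, hk⟩, Prod.ext h rfl⟩
  · rintro ⟨⟨t, k⟩, ⟨ht, hk⟩, h⟩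
    obtain ⟨rfl, rfl⟩ := Prod.mk.inj h
    exact ⟨ht, k, hk, rfl⟩

theorem volume_diff_mul_lintegral_le {n : ℕ} (hn : 1 ≤ n) {A B : Set (Fin n → ℝ)}
    (hA : IsCompact A) (hAc : Convex ℝ A) (hB : IsCompact B) {a b : ℝ} (ha : 0 < a) (hb : 0 < b)
    (hAa : ENNReal.ofReal (a ^ n) ≤ volume A) (hBb : ENNReal.ofReal (b ^ n) ≤ volume B) :
    (∫⁻ t in Set.Icc (0 : ℝ) 1,
        ENNReal.ofReal (n * a * (t * a + b) ^ (n - 1)) * ENNReal.ofReal ((1 - t) ^ n))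
      * volume (A - A) ≤ volume (A + B) ^ 2 := by
  have hK : IsCompact (A - A) := by
    rw [sub_eq_add_neg]
    exact hA.add hA.neg
  set G : Set ((Fin n → ℝ) × ℝ) := {z | z.2 ∈ Set.Icc (0 : ℝ) 1 ∧ z.1 ∈ (1 - z.2) • (A - A)}
    with hG
  have hGc : IsCompact G := isCompact_dilation_graph hK
  set w : ℝ → ENNReal := fun t => ENNReal.ofReal (n * a * (t * a + b) ^ (n - 1)) with hw
  have hwm : Measurable w := by fun_prop
  have slice : ∀ d, IsCompact (Prod.mk d ⁻¹' G) := fun d =>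
    (Topology.IsClosedEmbedding.of_continuous_injective_isClosedMap (by fun_prop)
      (Prod.mk_right_injective d) (isClosedMap_prodMk_left d)).isCompact_preimage hGc
  rw [volume_sq_eq_lintegral_inter (hA.add hB).measurableSet]
  calc _ = ∫⁻ t, ∫⁻ d, G.indicator (fun z => w z.2) (d, t) := by
        rw [← lintegral_mul_const _ (by fun_prop), ← lintegral_indicator measurableSet_Icc]
        refine lintegral_congr fun t => ?_
        by_cases ht : t ∈ Set.Icc (0 : ℝ) 1
        · have e : ∀ d, G.indicator (fun z => w z.2) (d, t)
              = ((1 - t) • (A - A)).indicator (fun _ => w t) d := fun d => by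
            by_cases hd : d ∈ (1 - t) • (A - A)
            · rw [Set.indicator_of_mem hd, Set.indicator_of_mem (show (d, t) ∈ G from ⟨ht, hd⟩)]
            · rw [Set.indicator_of_notMem hd, Set.indicator_of_notMem fun h => hd h.2]
          simp only [e]
          rw [lintegral_indicator (hK.smul _).measurableSet, setLIntegral_const,
            Measure.addHaar_smul, Module.finrank_fin_fun, Set.indicator_of_mem ht,
            abs_of_nonneg (pow_nonneg (by linarith [ht.2]) n), mul_assoc]
        · have e : ∀ d, G.indicator (fun z => w z.2) (d, t) = 0 := fun d =>
            Set.indicator_of_notMem (fun h => ht h.1) _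
          simp [e, ht]
    _ = ∫⁻ d, ∫⁻ t, G.indicator (fun z => w z.2) (d, t) :=
        (lintegral_lintegral_swap (f := fun d t => G.indicator (fun z => w z.2) (d, t))
          (((hwm.comp measurable_snd).indicator hGc.measurableSet).aemeasurable)).symm
    _ ≤ _ := by
        refine lintegral_mono fun d => ?_
        have e : ∀ t, G.indicator (fun z => w z.2) (d, t) = (Prod.mk d ⁻¹' G).indicator w t :=
          fun t => rfl
        simp only [e]
        rw [lintegral_indicator (slice d).measurableSet]
        exact lintegral_deriv_le_of_isCompact ha hb (slice d) (fun t ht => ht.1.1) fun t ht =>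
          le_volume_inter_translate hn hA hAc hB ha hb hAa hBb ht.1.1 ht.1.2 ht.2

theorem le_deriv_mul_one_sub_pow {n : ℕ} (hn : 1 ≤ n) {a b : ℝ} (hb : 0 < b) (hab : b ≤ a)
    {t : ℝ} (ht0 : 0 ≤ t) (ht : t ≤ 1 / (2 * √n)) :
    3 / 8 * n * a * b ^ (n - 1) ≤ n * a * (t * a + b) ^ (n - 1) * (1 - t) ^ n := by
  obtain ⟨m, rfl⟩ : ∃ m, n = m + 1 := ⟨n - 1, by omega⟩
  rw [Nat.add_sub_cancel]
  have hs : 1 ≤ √((m + 1 : ℕ) : ℝ) := Real.one_le_sqrt.2 (by exact_mod_cast hn)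
  have hs2 : √((m + 1 : ℕ) : ℝ) ^ 2 = m + 1 := by
    rw [Real.sq_sqrt (by positivity)]; push_cast; ring
  rw [le_div_iff₀ (by positivity)] at ht
  have ht2 : t ≤ 1 / 2 := by nlinarith
  have hmt : m * t ^ 2 ≤ 1 / 4 := by
    have : (t * (2 * √((m + 1 : ℕ) : ℝ))) ^ 2 ≤ 1 := pow_le_one₀ (by positivity) ht
    rw [mul_pow, mul_pow, hs2] at this
    nlinarith [sq_nonneg t]
  have bern : 3 / 4 ≤ (1 - t ^ 2) ^ m := by
    have := one_add_mul_le_pow (a := -t ^ 2) (by nlinarith) m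
    rw [← sub_eq_add_neg] at this
    linarith
  calc 3 / 8 * ((m + 1 : ℕ) : ℝ) * a * b ^ m
      = ((m + 1 : ℕ) : ℝ) * a * b ^ m * (3 / 4 * (1 / 2)) := by ring
    _ ≤ ((m + 1 : ℕ) : ℝ) * a * b ^ m * ((1 - t ^ 2) ^ m * (1 - t)) := by
        have : 0 < a := by linarith
        gcongr
        linarith
    _ = ((m + 1 : ℕ) : ℝ) * a * (b * (1 + t)) ^ m * (1 - t) ^ (m + 1) := by
        rw [show 1 - t ^ 2 = (1 + t) * (1 - t) by ring, mul_pow, mul_pow]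
        ring
    _ ≤ _ := by
        have : 0 < a := by linarith
        have : 0 ≤ 1 - t := by linarith
        gcongr
        nlinarith

theorem le_lintegral_deriv_mul_one_sub_pow {n : ℕ} (hn : 1 ≤ n) {a b : ℝ} (hb : 0 < b)
    (hab : b ≤ a) :
    ENNReal.ofReal (3 / 16 * √n * a * b ^ (n - 1)) ≤ ∫⁻ t in Set.Icc (0 : ℝ) 1,
        ENNReal.ofReal (n * a * (t * a + b) ^ (n - 1)) * ENNReal.ofReal ((1 - t) ^ n) := by
  have ha : 0 < a := hb.trans_le hab
  have hs : 1 ≤ √(n : ℝ) := Real.one_le_sqrt.2 (by exact_mod_cast hn)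
  have h1 : 1 / (2 * √(n : ℝ)) ≤ 1 := by
    rw [div_le_one (by positivity)]; linarith
  calc ENNReal.ofReal (3 / 16 * √n * a * b ^ (n - 1))
      = ∫⁻ _ in Set.Icc (0 : ℝ) (1 / (2 * √n)),
          ENNReal.ofReal (3 / 8 * n * a * b ^ (n - 1)) := by
        rw [setLIntegral_const, Real.volume_Icc, ← ENNReal.ofReal_mul (by positivity)]
        congr 1
        nth_rewrite 2 [← Real.sq_sqrt (Nat.cast_nonneg n)]
        field_simp
        ring
    _ ≤ ∫⁻ t in Set.Icc (0 : ℝ) (1 / (2 * √n)),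
          ENNReal.ofReal (n * a * (t * a + b) ^ (n - 1)) * ENNReal.ofReal ((1 - t) ^ n) := by
        refine setLIntegral_mono' measurableSet_Icc fun t ht => ?_
        have := ht.1
        rw [← ENNReal.ofReal_mul (by positivity)]
        exact ENNReal.ofReal_le_ofReal (le_deriv_mul_one_sub_pow hn hb hab ht.1 ht.2)
    _ ≤ _ := lintegral_mono_set (Set.Icc_subset_Icc_right h1)

theorem diff_le_sumset_sq_of_le :
    ∃ C : ℝ, 0 < C ∧ ∀ n : ℕ, 1 ≤ n → ∀ A B : Set (Fin n → ℝ),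
      IsCompact A → Convex ℝ A → IsCompact B →
      0 < volume B → volume B ≤ volume A →
      (volume (A - A)).toReal
        ≤ C * (volume (A + B)).toReal ^ 2 /
            (Real.sqrt n * (volume A).toReal ^ ((1 : ℝ) / n) *
              (volume B).toReal ^ (1 - (1 : ℝ) / n)) := by
  refine ⟨16 / 3, by norm_num, fun n hn A B hA hAc hB hBpos hBA => ?_⟩
  have hn0 : n ≠ 0 := by omega
  have hnR : (0 : ℝ) < n := by positivity
  have hAfin := hA.measure_lt_top (μ := volume).ne
  have hBfin := hB.measure_lt_top (μ := volume).ne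
  have hBR : 0 < (volume B).toReal := ENNReal.toReal_pos hBpos.ne' hBfin
  have hBAR : (volume B).toReal ≤ (volume A).toReal := ENNReal.toReal_mono hAfin hBA
  have hAR : 0 < (volume A).toReal := hBR.trans_le hBAR
  set a : ℝ := (volume A).toReal ^ ((1 : ℝ) / n) with ha
  set b : ℝ := (volume B).toReal ^ ((1 : ℝ) / n) with hb
  have han : a ^ n = (volume A).toReal := by
    rw [ha, one_div, Real.rpow_inv_natCast_pow hAR.le hn0]
  have hbn : b ^ n = (volume B).toReal := by
    rw [hb, one_div, Real.rpow_inv_natCast_pow hBR.le hn0]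
  have ha0 : 0 < a := by positivity
  have hb0 : 0 < b := by positivity
  have hab : b ≤ a := by rw [ha, hb]; gcongr
  have hbp : (volume B).toReal ^ (1 - (1 : ℝ) / n) = b ^ (n - 1) := by
    rw [hb, ← Real.rpow_natCast, ← Real.rpow_mul hBR.le, Nat.cast_sub hn]
    congr 1
    field_simp
    simp
  have key := (mul_le_mul_left (le_lintegral_deriv_mul_one_sub_pow hn hb0 hab) _).trans
    (volume_diff_mul_lintegral_le hn hA hAc hB ha0 hb0
      (by rw [han, ENNReal.ofReal_toReal hAfin]) (by rw [hbn, ENNReal.ofReal_toReal hBfin]))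
  have key' := ENNReal.toReal_mono
    (ENNReal.pow_ne_top (hA.add hB).measure_lt_top.ne) key
  rw [ENNReal.toReal_mul, ENNReal.toReal_ofReal (by positivity), ENNReal.toReal_pow] at key'
  rw [hbp, le_div_iff₀ (by positivity)]
  linarith
end

section
/- There exists an absolute constant $C > 0$ (independent of $n$) such that the following holds. Let $A \subseteq \mathbb{R}^n$ be a compact convex set with $\mu(A) > 0$ and let $B \subseteq \mathbb{R}^n$ be a compact set with $\mu(B) \ge \mu(A)$. Then $\mu(A - A) \le C\, \frac{\mu(A+B)^2}{\sqrt{n}\, \mu(A)}$. -/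
open MeasureTheory Pointwise

open scoped ENNReal NNReal

namespace ENNReal

lemma four_mul_mul_le_add_sq (x y : ℝ≥0∞) : 4 * (x * y) ≤ (x + y) ^ 2 := by
  rcases eq_or_ne x ⊤ with rfl | hx
  · simp
  rcases eq_or_ne y ⊤ with rfl | hy
  · simp
  lift x to ℝ≥0 using hx
  lift y to ℝ≥0 using hy
  have h := four_mul_le_sq_add x y
  rw [mul_assoc] at h
  exact_mod_cast h

end ENNReal

lemma Nat.centralBinom_sq_mul_le (n : ℕ) : n.centralBinom ^ 2 * (2 * n + 1) ≤ 16 ^ n := by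
  induction n with
  | zero => simp
  | succ n ih =>
    have h := Nat.succ_mul_centralBinom_succ n
    refine Nat.le_of_mul_le_mul_left ?_ (pow_pos n.succ_pos 2)
    calc (n + 1) ^ 2 * ((n + 1).centralBinom ^ 2 * (2 * (n + 1) + 1))
        = ((n + 1) * (n + 1).centralBinom) ^ 2 * (2 * (n + 1) + 1) := by ring
      _ = (4 * (2 * n + 1) * (2 * n + 3)) * (n.centralBinom ^ 2 * (2 * n + 1)) := by
          rw [h]; ring
      _ ≤ (16 * (n + 1) ^ 2) * 16 ^ n := by
          refine Nat.mul_le_mul ?_ ih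
          nlinarith
      _ = (n + 1) ^ 2 * 16 ^ (n + 1) := by ring

lemma Nat.centralBinom_mul_sqrt_le (n : ℕ) : (n.centralBinom : ℝ) * √n ≤ 4 ^ n := by
  have h : (n.centralBinom : ℝ) ^ 2 * (2 * n + 1) ≤ 16 ^ n := by
    exact_mod_cast n.centralBinom_sq_mul_le
  refine abs_le_of_sq_le_sq' ?_ (by positivity) |>.2
  rw [mul_pow, Real.sq_sqrt (by positivity), ← pow_mul, mul_comm n 2, pow_mul]
  norm_num
  refine le_trans ?_ h
  gcongr
  linarith [(n.cast_nonneg : (0 : ℝ) ≤ n)]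

lemma Convex.exists_smul_vadd_subset_inter {E : Type*} [AddCommGroup E] [Module ℝ E]
    {A : Set E} (hA : Convex ℝ A) {s : ℝ} (hs : s ∈ Set.Icc (0 : ℝ) 1) {d : E} (hd : d ∈ A - A) :
    ∃ a : E, a +ᵥ (1 - s) • A ⊆ A ∩ (s • d +ᵥ A) := by
  obtain ⟨a, ha, a', ha', rfl⟩ := hd
  refine ⟨s • a, ?_⟩
  rintro _ ⟨_, ⟨y, hy, rfl⟩, rfl⟩
  have h₀ : 0 ≤ 1 - s := sub_nonneg.2 hs.2
  refine ⟨hA ha hy hs.1 h₀ (by ring), s • a' + (1 - s) • y,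
    hA ha' hy hs.1 h₀ (by ring), ?_⟩
  simp only [vadd_eq_add, smul_sub]
  abel

namespace MeasureTheory

lemma volume_add_le_of_isCompact {K L U : Set ℝ} (hK : IsCompact K) (hL : IsCompact L)
    (hK₀ : K.Nonempty) (hL₀ : L.Nonempty) (hU : K + L ⊆ U) :
    volume K + volume L ≤ volume U := by
  obtain ⟨a, ha, hKa⟩ := hK.exists_isGreatest hK₀
  obtain ⟨b, hb, hLb⟩ := hL.exists_isLeast hL₀
  have hinter : (b +ᵥ K) ∩ (a +ᵥ L) ⊆ {a + b} := by
    rintro _ ⟨⟨x, hx, rfl⟩, ⟨y, hy, hxy⟩⟩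
    have h₁ := hKa hx
    have h₂ := hLb hy
    simp only [vadd_eq_add] at hxy
    simp only [vadd_eq_add, Set.mem_singleton_iff]
    linarith
  have hdisj : AEDisjoint volume (b +ᵥ K) (a +ᵥ L) :=
    measure_mono_null hinter (by simp)
  calc volume K + volume L = volume (b +ᵥ K) + volume (a +ᵥ L) := by
        rw [measure_vadd, measure_vadd]
    _ = volume ((b +ᵥ K) ∪ (a +ᵥ L)) :=
        (measure_union₀ (hL.vadd a).measurableSet.nullMeasurableSet hdisj).symm
    _ ≤ volume U := by
        refine measure_mono (Set.union_subset ?_ ?_)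
        · rintro _ ⟨x, hx, rfl⟩
          exact hU ⟨x, hx, b, hb, add_comm _ _⟩
        · rintro _ ⟨y, hy, rfl⟩
          exact hU ⟨a, ha, y, hy, rfl⟩

/-- The one-dimensional Brunn–Minkowski inequality. -/
lemma volume_add_le_of_add_subset {S T U : Set ℝ} (hS : MeasurableSet S) (hT : MeasurableSet T)
    (hS₀ : S.Nonempty) (hT₀ : T.Nonempty) (hU : S + T ⊆ U) :
    volume S + volume T ≤ volume U := by
  obtain ⟨a, ha⟩ := hS₀
  obtain ⟨b, hb⟩ := hT₀
  have key : ∀ K ⊆ S, IsCompact K → ∀ L ⊆ T, IsCompact L → volume K + volume L ≤ volume U := by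
    intro K hKS hK L hLT hL
    calc volume K + volume L ≤ volume (insert a K) + volume (insert b L) := by
          gcongr <;> exact Set.subset_insert _ _
      _ ≤ volume U :=
          volume_add_le_of_isCompact (hK.insert a) (hL.insert b) (Set.insert_nonempty _ _)
            (Set.insert_nonempty _ _) ((Set.add_subset_add (Set.insert_subset ha hKS)
              (Set.insert_subset hb hLT)).trans hU)
  rw [hS.measure_eq_iSup_isCompact, hT.measure_eq_iSup_isCompact]
  refine ENNReal.biSup_add_biSup_le' (p := fun K ↦ K ⊆ S) (q := fun L ↦ L ⊆ T)
    ⟨∅, Set.empty_subset _⟩ ⟨∅, Set.empty_subset _⟩ fun K hKS L hLT ↦ ?_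
  by_cases hK : IsCompact K <;> by_cases hL : IsCompact L <;>
    simp only [hK, hL, iSup_pos, iSup_neg,
    not_false_eq_true, bot_eq_zero, add_zero, zero_add]
  · exact key K hKS hK L hLT hL
  · simpa using key K hKS hK ∅ (Set.empty_subset _) isCompact_empty
  · simpa using key ∅ (Set.empty_subset _) isCompact_empty L hLT hL
  · exact zero_le

lemma lintegral_eq_lintegral_meas_ofReal_lt {α : Type*} [MeasurableSpace α] (μ : Measure α)
    {f : α → ℝ≥0∞} (hf : Measurable f) (hf_top : ∀ x, f x ≠ ⊤) :
    ∫⁻ x, f x ∂μ = ∫⁻ t in Set.Ioi (0 : ℝ), μ {x | ENNReal.ofReal t < f x} := by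
  have h := lintegral_eq_lintegral_meas_lt μ (f := fun x ↦ (f x).toReal)
    (Filter.Eventually.of_forall fun _ ↦ ENNReal.toReal_nonneg) hf.ennreal_toReal.aemeasurable
  simp only [ENNReal.ofReal_toReal (hf_top _)] at h
  rw [h]
  refine setLIntegral_congr_fun measurableSet_Ioi fun t (ht : 0 < t) ↦ ?_
  simp only [ENNReal.ofReal_lt_iff_lt_toReal ht.le (hf_top _)]

lemma lintegral_add_lintegral_le_of_iSup_eq_one {f g h : ℝ → ℝ≥0∞} (hf : Measurable f)
    (hg : Measurable g) (hh : Measurable h) (hf₁ : ⨆ x, f x = 1) (hg₁ : ⨆ x, g x = 1)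
    (hfg : ∀ x y, f x * g y ≤ h (x + y) ^ 2) :
    (∫⁻ x, f x) + ∫⁻ x, g x ≤ ∫⁻ x, h x := by
  have hf_le : ∀ x, f x ≤ 1 := fun x ↦ (le_iSup f x).trans hf₁.le
  have hg_le : ∀ x, g x ≤ 1 := fun x ↦ (le_iSup g x).trans hg₁.le
  have hmin : ∀ x, min (h x) 1 ≠ ⊤ := fun x ↦
    ((min_le_right _ _).trans_lt ENNReal.one_lt_top).ne
  have hf_top : ∀ x, f x ≠ ⊤ := fun x ↦ ((hf_le x).trans_lt ENNReal.one_lt_top).ne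
  have hg_top : ∀ x, g x ≠ ⊤ := fun x ↦ ((hg_le x).trans_lt ENNReal.one_lt_top).ne
  refine le_trans ?_ (lintegral_mono fun x ↦ min_le_left (h x) 1)
  rw [lintegral_eq_lintegral_meas_ofReal_lt _ hf hf_top,
    lintegral_eq_lintegral_meas_ofReal_lt _ hg hg_top,
    lintegral_eq_lintegral_meas_ofReal_lt _ (hh.min measurable_const) hmin]
  refine (le_lintegral_add _ _).trans (lintegral_mono fun t ↦ ?_)
  rcases lt_or_ge (ENNReal.ofReal t) 1 with ht | ht
  · refine volume_add_le_of_add_subset (measurableSet_lt measurable_const hf)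
      (measurableSet_lt measurable_const hg) (lt_iSup_iff.1 (ht.trans_eq hf₁.symm))
      (lt_iSup_iff.1 (ht.trans_eq hg₁.symm)) ?_
    rintro _ ⟨x, hx, y, hy, rfl⟩
    refine lt_min ?_ ht
    by_contra! hle
    refine (lt_of_lt_of_le (ENNReal.mul_lt_mul hx hy) (hfg x y)).not_ge ?_
    rw [← sq]
    exact pow_le_pow_left₀ zero_le hle 2
  · have h₁ : {x | ENNReal.ofReal t < f x} = ∅ :=
      Set.eq_empty_of_forall_notMem fun x hx ↦ (lt_of_lt_of_le hx (hf_le x)).not_ge ht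
    have h₂ : {x | ENNReal.ofReal t < g x} = ∅ :=
      Set.eq_empty_of_forall_notMem fun x hx ↦ (lt_of_lt_of_le hx (hg_le x)).not_ge ht
    simp [h₁, h₂]

lemma four_mul_lintegral_mul_lintegral_le_of_iSup_ne_top {f g h : ℝ → ℝ≥0∞} (hf : Measurable f)
    (hg : Measurable g) (hh : Measurable h) (hf_top : ⨆ x, f x ≠ ⊤) (hg_top : ⨆ x, g x ≠ ⊤)
    (hfg : ∀ x y, f x * g y ≤ h (x + y) ^ 2) :
    4 * ((∫⁻ x, f x) * ∫⁻ x, g x) ≤ (∫⁻ x, h x) ^ 2 := by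
  rcases eq_or_ne (⨆ x, f x) 0 with hf₀ | hf₀
  · simp [ENNReal.iSup_eq_zero.1 hf₀]
  rcases eq_or_ne (⨆ x, g x) 0 with hg₀ | hg₀
  · simp [ENNReal.iSup_eq_zero.1 hg₀]
  set a := ⨆ x, f x with ha
  set b := ⨆ x, g x with hb
  obtain ⟨c, hc⟩ : ∃ c : ℝ≥0∞, c ^ 2 = a * b :=
    ⟨(a * b) ^ (1 / 2 : ℝ), by rw [← ENNReal.rpow_natCast, ← ENNReal.rpow_mul]; norm_num⟩
  have hscaled := lintegral_add_lintegral_le_of_iSup_eq_one (f := fun x ↦ a⁻¹ * f x)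
    (g := fun x ↦ b⁻¹ * g x) (h := fun x ↦ c⁻¹ * h x) (hf.const_mul _) (hg.const_mul _)
    (hh.const_mul _) (by rw [← ENNReal.mul_iSup, ← ha, ENNReal.inv_mul_cancel hf₀ hf_top])
    (by rw [← ENNReal.mul_iSup, ← hb, ENNReal.inv_mul_cancel hg₀ hg_top]) (fun x y ↦ by
      rw [mul_pow, ← ENNReal.inv_pow, hc, ENNReal.mul_inv (.inl hf₀) (.inl hf_top),
        mul_mul_mul_comm]
      gcongr
      exact hfg x y)
  rw [lintegral_const_mul _ hf, lintegral_const_mul _ hg, lintegral_const_mul _ hh] at hscaled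
  have hsq := (ENNReal.four_mul_mul_le_add_sq _ _).trans (pow_le_pow_left₀ zero_le hscaled 2)
  have hab₀ : a * b ≠ 0 := mul_ne_zero hf₀ hg₀
  have hab_top : a * b ≠ ⊤ := ENNReal.mul_ne_top hf_top hg_top
  rw [mul_pow, ← ENNReal.inv_pow, hc, mul_mul_mul_comm, ← ENNReal.mul_inv (.inl hf₀) (.inl hf_top),
    mul_left_comm] at hsq
  exact (ENNReal.mul_le_mul_iff_right (ENNReal.inv_ne_zero.2 hab_top)
    (ENNReal.inv_ne_top.2 hab₀)).1 hsq

/-- The one-dimensional Prékopa–Leindler inequality with equal weights. -/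
lemma four_mul_lintegral_mul_lintegral_le {f g h : ℝ → ℝ≥0∞} (hf : Measurable f)
    (hg : Measurable g) (hh : Measurable h) (hfg : ∀ x y, f x * g y ≤ h (x + y) ^ 2) :
    4 * ((∫⁻ x, f x) * ∫⁻ x, g x) ≤ (∫⁻ x, h x) ^ 2 := by
  have hlim : ∀ {u : ℝ → ℝ≥0∞}, Measurable u →
      Filter.Tendsto (fun N : ℕ ↦ ∫⁻ x, min (u x) N) Filter.atTop (nhds (∫⁻ x, u x)) := by
    intro u hu
    refine lintegral_tendsto_of_tendsto_of_monotone
      (fun N ↦ (hu.min measurable_const).aemeasurable)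
      (Filter.Eventually.of_forall fun x N M hNM ↦ min_le_min le_rfl (by exact_mod_cast hNM))
      (Filter.Eventually.of_forall fun x ↦ ?_)
    simpa using tendsto_const_nhds.min ENNReal.tendsto_nat_nhds_top
  have hbound : ∀ (N : ℕ) (u : ℝ → ℝ≥0∞), ⨆ x, min (u x) N ≠ ⊤ := fun N u ↦
    ((iSup_le fun x ↦ min_le_right (u x) N).trans_lt (ENNReal.natCast_lt_top N)).ne
  have htrunc : ∀ N M : ℕ,
      4 * ((∫⁻ x, min (f x) N) * ∫⁻ x, min (g x) M) ≤ (∫⁻ x, h x) ^ 2 := fun N M ↦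
    four_mul_lintegral_mul_lintegral_le_of_iSup_ne_top (hf.min measurable_const)
      (hg.min measurable_const) hh (hbound N f) (hbound M g) fun x y ↦
        (mul_le_mul' (min_le_left _ _) (min_le_left _ _)).trans (hfg x y)
  have hsup : ∀ {u : ℝ → ℝ≥0∞}, Measurable u → ∫⁻ x, u x = ⨆ N : ℕ, ∫⁻ x, min (u x) N :=
    fun hu ↦ (tendsto_nhds_unique (hlim hu) (tendsto_atTop_iSup fun N M hNM ↦
      lintegral_mono fun x ↦ min_le_min le_rfl (by exact_mod_cast hNM)))
  rw [hsup hf, hsup hg, ENNReal.iSup_mul, ENNReal.mul_iSup]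
  refine iSup_le fun N ↦ ?_
  rw [ENNReal.mul_iSup, ENNReal.mul_iSup]
  exact iSup_le fun M ↦ htrunc N M

lemma lintegral_fin_succ {n : ℕ} {f : (Fin (n + 1) → ℝ) → ℝ≥0∞} (hf : Measurable f) :
    ∫⁻ x, f x = ∫⁻ t : ℝ, ∫⁻ y : Fin n → ℝ, f (Fin.cons t y) := by
  have hmp := (volume_preserving_piFinSuccAbove (fun _ : Fin (n + 1) ↦ ℝ) 0).symm
  rw [← hmp.lintegral_comp hf, Measure.volume_eq_prod, lintegral_prod]
  · simp [MeasurableEquiv.piFinSuccAbove, Fin.insertNthEquiv]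
  · exact (hf.comp hmp.measurable).aemeasurable

/-- The Prékopa–Leindler inequality with equal weights. -/
theorem four_pow_mul_lintegral_mul_lintegral_le (n : ℕ) {f g h : (Fin n → ℝ) → ℝ≥0∞}
    (hf : Measurable f) (hg : Measurable g) (hh : Measurable h)
    (hfg : ∀ x y, f x * g y ≤ h (x + y) ^ 2) :
    4 ^ n * ((∫⁻ x, f x) * ∫⁻ x, g x) ≤ (∫⁻ x, h x) ^ 2 := by
  induction n with
  | zero =>
    have := hfg default default
    rw [Subsingleton.elim (default + default) (default : Fin 0 → ℝ)] at this
    simp only [volume_pi, Measure.pi_of_empty _ default, lintegral_dirac, pow_zero, one_mul]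
    exact this
  | succ n ih =>
    have hcons : Measurable fun p : ℝ × (Fin n → ℝ) ↦ (Fin.cons p.1 p.2 : Fin (n + 1) → ℝ) := by
      refine measurable_pi_iff.2 fun i ↦ ?_
      refine Fin.cases ?_ (fun j ↦ ?_) i
      · simpa using measurable_fst
      · simpa [Function.comp_def] using (measurable_pi_apply j).comp measurable_snd
    have hcons' : ∀ t : ℝ, Measurable fun y : Fin n → ℝ ↦ (Fin.cons t y : Fin (n + 1) → ℝ) :=
      fun t ↦ hcons.comp measurable_prodMk_left
    have hslice := four_mul_lintegral_mul_lintegral_le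
      (f := fun s ↦ 4 ^ n * ∫⁻ y : Fin n → ℝ, f (Fin.cons s y))
      (g := fun s ↦ ∫⁻ y : Fin n → ℝ, g (Fin.cons s y))
      (h := fun s ↦ ∫⁻ y : Fin n → ℝ, h (Fin.cons s y))
      ((hf.comp hcons).lintegral_prod_right'.const_mul _)
      (hg.comp hcons).lintegral_prod_right' (hh.comp hcons).lintegral_prod_right'
      (fun s t ↦ by
        rw [mul_assoc]
        refine ih (hf.comp (hcons' s)) (hg.comp (hcons' t)) (hh.comp (hcons' (s + t)))
          fun x y ↦ (hfg _ _).trans_eq ?_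
        congr 2
        ext i
        refine Fin.cases ?_ (fun j ↦ ?_) i <;> simp)
    have hf_slice : Measurable fun s ↦ ∫⁻ y : Fin n → ℝ, f (Fin.cons s y) :=
      (hf.comp hcons).lintegral_prod_right'
    rw [lintegral_const_mul _ hf_slice] at hslice
    rw [lintegral_fin_succ hf, lintegral_fin_succ hg, lintegral_fin_succ hh, pow_succ']
    simpa only [mul_assoc] using hslice

/-- The multiplicative Brunn–Minkowski inequality for a Minkowski sum of compact sets. -/
theorem four_pow_mul_volume_mul_volume_le {n : ℕ} {A B : Set (Fin n → ℝ)} (hA : IsCompact A)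
    (hB : IsCompact B) : 4 ^ n * (volume A * volume B) ≤ volume (A + B) ^ 2 := by
  have hA' := hA.measurableSet
  have hB' := hB.measurableSet
  have hAB' := (hA.add hB).measurableSet
  have := four_pow_mul_lintegral_mul_lintegral_le n (f := A.indicator 1) (g := B.indicator 1)
    (h := (A + B).indicator 1) (measurable_one.indicator hA') (measurable_one.indicator hB')
    (measurable_one.indicator hAB') fun x y ↦ by
      by_cases hx : x ∈ A <;> by_cases hy : y ∈ B <;> simp [hx, hy, Set.add_mem_add]
  simpa only [lintegral_indicator_one, hA', hB', hAB'] using this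

lemma lintegral_pow_mul_one_sub_pow (m : ℕ) :
    ∫⁻ s in Set.Ioo (0 : ℝ) 1, ENNReal.ofReal (s ^ (m + 1) * ((m + 1) * (1 - s) ^ m)) =
      ENNReal.ofReal (1 / (m + 1).centralBinom) := by
  have hb : ProbabilityTheory.beta (m + 2) (m + 1) * (m + 1) = 1 / (m + 1).centralBinom := by
    have h₁ := Real.Gamma_nat_eq_factorial (m + 1)
    have h₂ := Real.Gamma_nat_eq_factorial m
    have h₃ := Real.Gamma_nat_eq_factorial (2 * m + 2)
    push_cast at h₁ h₂ h₃
    have hc := Nat.choose_mul_factorial_mul_factorial (n := 2 * (m + 1)) (k := m + 1) (by omega)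
    rw [show 2 * (m + 1) - (m + 1) = m + 1 by omega, ← Nat.centralBinom_eq_two_mul_choose] at hc
    have hc' : ((m + 1).centralBinom : ℝ) * (m + 1).factorial * (m + 1).factorial
        = (2 * m + 2).factorial := by exact_mod_cast hc
    have hpos : ((m + 1).centralBinom : ℝ) ≠ 0 := by
      exact_mod_cast Nat.centralBinom_ne_zero _
    rw [ProbabilityTheory.beta, show (m + 2 : ℝ) = m + 1 + 1 by ring, h₁, h₂,
      show (m + 1 + 1 + (m + 1) : ℝ) = 2 * m + 2 + 1 by ring, h₃, ← hc']
    have : ((m + 1).factorial : ℝ) = (m + 1) * m.factorial := by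
      exact_mod_cast Nat.factorial_succ m
    rw [this]
    field_simp
  have hpos : 0 < ProbabilityTheory.beta (m + 2) (m + 1) :=
    ProbabilityTheory.beta_pos (by positivity) (by positivity)
  have hone := ProbabilityTheory.lintegral_betaPDF_eq_one (α := m + 2) (β := m + 1)
    (by positivity) (by positivity)
  rw [ProbabilityTheory.lintegral_betaPDF] at hone
  rw [← hb, ← mul_one (ENNReal.ofReal _), ← hone, ← lintegral_const_mul _ (by fun_prop)]
  refine setLIntegral_congr_fun measurableSet_Ioo fun s hs ↦ ?_
  rw [← ENNReal.ofReal_mul (by positivity), show (m + 2 - 1 : ℝ) = (m + 1 : ℕ) by push_cast; ring,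
    add_sub_cancel_right, Real.rpow_natCast, Real.rpow_natCast]
  congr 1
  field_simp

lemma setLIntegral_Icc_succ_mul_one_sub_pow (m : ℕ) {a : ℝ} (ha : a ≤ 1) :
    ∫⁻ s in Set.Icc a 1, ENNReal.ofReal ((m + 1) * (1 - s) ^ m) =
      ENNReal.ofReal ((1 - a) ^ (m + 1)) := by
  rw [← ofReal_integral_eq_lintegral_ofReal]
  · rw [integral_Icc_eq_integral_Ioc, ← intervalIntegral.integral_of_le ha,
      intervalIntegral.integral_comp_sub_left (fun s ↦ (m + 1) * s ^ m) 1]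
    simp [integral_pow]
    field_simp
  · exact (Continuous.continuousOn (by fun_prop)).integrableOn_Icc
  · refine ae_restrict_of_forall_mem measurableSet_Icc fun s hs ↦ ?_
    have := sub_nonneg.2 hs.2
    simp only [Pi.zero_apply]
    positivity

section RogersShephard

variable {E : Type*} [NormedAddCommGroup E] [NormedSpace ℝ E] [MeasurableSpace E] [BorelSpace E]
  [FiniteDimensional ℝ E] (μ : Measure E) [μ.IsAddHaarMeasure] {A : Set E}

lemma lintegral_measure_inter_vadd (hA : MeasurableSet A) :
    ∫⁻ x, μ (A ∩ (x +ᵥ A)) ∂μ = μ A * μ A := by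
  have hmeas : MeasurableSet {p : E × E | p.2 ∈ A ∧ p.2 - p.1 ∈ A} :=
    (measurable_snd hA).inter ((measurable_snd.sub measurable_fst) hA)
  have hx : ∀ x : E, A ∩ (x +ᵥ A) = Prod.mk x ⁻¹' {p : E × E | p.2 ∈ A ∧ p.2 - p.1 ∈ A} := by
    intro x
    ext y
    simp [Set.mem_vadd_set_iff_neg_vadd_mem, neg_add_eq_sub]
  simp_rw [hx]
  rw [← Measure.prod_apply hmeas, Measure.prod_apply_symm hmeas]
  have hy : ∀ y : E, μ ((fun x ↦ (x, y)) ⁻¹' {p : E × E | p.2 ∈ A ∧ p.2 - p.1 ∈ A}) =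
      A.indicator (fun _ ↦ μ A) y := by
    intro y
    by_cases hyA : y ∈ A
    · simp only [Set.preimage_ofPred_eq, hyA, true_and, Set.indicator_of_mem]
      exact (Measure.measurePreserving_sub_left μ y).measure_preimage hA.nullMeasurableSet
    · simp [hyA]
  simp_rw [hy]
  rw [lintegral_indicator_const hA]

/-- The covariogram of a convex set `A` is bounded below on `s • (A - A)`. -/
lemma _root_.Convex.ofReal_pow_mul_le_measure_inter_vadd (hA : Convex ℝ A) {s : ℝ}
    (hs : s ∈ Set.Ioo (0 : ℝ) 1) {x : E} (hx : s⁻¹ • x ∈ A - A) :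
    ENNReal.ofReal ((1 - s) ^ Module.finrank ℝ E) * μ A ≤ μ (A ∩ (x +ᵥ A)) := by
  obtain ⟨a, ha⟩ := hA.exists_smul_vadd_subset_inter ⟨hs.1.le, hs.2.le⟩ hx
  rw [smul_inv_smul₀ hs.1.ne'] at ha
  refine le_trans (le_of_eq ?_) (measure_mono ha)
  rw [measure_vadd, Measure.addHaar_smul_of_nonneg _ (sub_nonneg.2 hs.2.le)]

lemma _root_.Convex.lintegral_mul_le_measure_inter_vadd (hA : Convex ℝ A) {m : ℕ}
    (hm : Module.finrank ℝ E = m + 1) (x : E) :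
    (∫⁻ s in Set.Ioo (0 : ℝ) 1, {s : ℝ | s⁻¹ • x ∈ A - A}.indicator
        (fun s ↦ ENNReal.ofReal ((m + 1) * (1 - s) ^ m)) s) * μ A ≤ μ (A ∩ (x +ᵥ A)) := by
  set S : Set ℝ := {s | s ∈ Set.Ioo (0 : ℝ) 1 ∧ s⁻¹ • x ∈ A - A} with hS
  rcases S.eq_empty_or_nonempty with hS₀ | hS₀
  · rw [setLIntegral_congr_fun measurableSet_Ioo (g := fun _ ↦ (0 : ℝ≥0∞))]
    · simp
    · intro s hs
      have hs' : s ∉ {s : ℝ | s⁻¹ • x ∈ A - A} :=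
        fun h ↦ Set.eq_empty_iff_forall_notMem.1 hS₀ s ⟨hs, h⟩
      simp only [Set.indicator_of_notMem hs']
  have hbdd : BddBelow S := ⟨0, fun s hs ↦ hs.1.1.le⟩
  have hinf : ENNReal.ofReal ((1 - sInf S) ^ (m + 1)) * μ A ≤ μ (A ∩ (x +ᵥ A)) := by
    by_cases hAtop : μ A = ⊤
    · obtain ⟨s, hs⟩ := hS₀
      have h := hA.ofReal_pow_mul_le_measure_inter_vadd μ hs.1 hs.2
      have hpos : 0 < (1 - s) ^ Module.finrank ℝ E := pow_pos (sub_pos.2 hs.1.2) _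
      rw [hAtop, ENNReal.mul_top (ENNReal.ofReal_pos.2 hpos).ne', top_le_iff] at h
      rw [h]
      exact le_top
    · have hcl : IsClosed {s : ℝ | ENNReal.ofReal ((1 - s) ^ (m + 1)) * μ A
          ≤ μ (A ∩ (x +ᵥ A))} :=
        isClosed_le ((ENNReal.continuous_mul_const hAtop).comp
          (ENNReal.continuous_ofReal.comp (by fun_prop))) continuous_const
      refine hcl.closure_subset_iff.2 (fun s hs ↦ ?_) (csInf_mem_closure hS₀ hbdd)
      simpa only [hm, Set.mem_ofPred_eq] using hA.ofReal_pow_mul_le_measure_inter_vadd μ hs.1 hs.2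
  refine le_trans ?_ hinf
  gcongr
  have hle : sInf S ≤ 1 := by
    obtain ⟨s, hs⟩ := hS₀
    exact (csInf_le hbdd hs).trans hs.1.2.le
  rw [← setLIntegral_Icc_succ_mul_one_sub_pow m hle, ← lintegral_indicator measurableSet_Ioo,
    ← lintegral_indicator measurableSet_Icc]
  refine lintegral_mono fun s ↦ ?_
  rw [Set.indicator_indicator]
  exact Set.indicator_le_indicator_of_subset (s := S) (t := Set.Icc (sInf S) 1)
    (fun s hs ↦ ⟨csInf_le hbdd hs, hs.1.2.le⟩) (fun _ ↦ zero_le) s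

/-- The Rogers–Shephard inequality for the difference body of a compact convex set. -/
theorem _root_.Convex.measure_sub_le_centralBinom_mul (hA : Convex ℝ A) (hAc : IsCompact A)
    {m : ℕ} (hm : Module.finrank ℝ E = m + 1) (hA₀ : μ A ≠ 0) :
    μ (A - A) ≤ (m + 1).centralBinom * μ A := by
  have hK : MeasurableSet (A - A) := by
    rw [sub_eq_add_neg]
    exact (hAc.add hAc.neg).measurableSet
  have hA_top : μ A ≠ ⊤ := hAc.measure_lt_top.ne
  have hmeas : MeasurableSet {p : E × ℝ | p.2⁻¹ • p.1 ∈ A - A} :=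
    (measurable_snd.inv.smul measurable_fst) hK
  set F : E → ℝ → ℝ≥0∞ := fun x s ↦ {s : ℝ | s⁻¹ • x ∈ A - A}.indicator
    (fun s ↦ ENNReal.ofReal ((m + 1) * (1 - s) ^ m)) s with hF
  have hF_meas : Measurable (Function.uncurry F) :=
    Measurable.indicator (f := fun p : E × ℝ ↦ ENNReal.ofReal ((m + 1) * (1 - p.2) ^ m))
      (by fun_prop) hmeas
  have hswap : ∫⁻ x, (∫⁻ s in Set.Ioo (0 : ℝ) 1, F x s) ∂μ =
      ENNReal.ofReal (1 / (m + 1).centralBinom) * μ (A - A) := by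
    rw [lintegral_lintegral_swap hF_meas.aemeasurable, ← lintegral_pow_mul_one_sub_pow,
      ← lintegral_mul_const _ (by fun_prop)]
    refine setLIntegral_congr_fun measurableSet_Ioo fun s hs ↦ ?_
    have hFs : (fun x ↦ F x s) = ((fun x : E ↦ s⁻¹ • x) ⁻¹' (A - A)).indicator
        (fun _ ↦ ENNReal.ofReal ((m + 1) * (1 - s) ^ m)) := rfl
    have hs' : 0 ≤ s ^ (m + 1) := pow_nonneg hs.1.le _
    rw [hFs, lintegral_indicator_const ((measurable_const_smul _) hK),
      Measure.addHaar_preimage_smul _ (inv_ne_zero hs.1.ne'), hm, inv_pow, inv_inv,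
      abs_of_nonneg hs', ENNReal.ofReal_mul hs']
    ring
  have hmain : ENNReal.ofReal (1 / (m + 1).centralBinom) * μ (A - A) * μ A ≤ μ A * μ A := by
    have hF_int : Measurable fun x ↦ ∫⁻ s in Set.Ioo (0 : ℝ) 1, F x s :=
      hF_meas.lintegral_prod_right'
    rw [← hswap, ← lintegral_mul_const _ hF_int,
      ← lintegral_measure_inter_vadd μ hAc.measurableSet]
    exact lintegral_mono fun x ↦ hA.lintegral_mul_le_measure_inter_vadd μ hm x
  rw [ENNReal.mul_le_mul_iff_left hA₀ hA_top] at hmain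
  have hc : (0 : ℝ) < (m + 1).centralBinom := by exact_mod_cast Nat.centralBinom_pos _
  rw [one_div, ENNReal.ofReal_inv_of_pos hc, ENNReal.ofReal_natCast,
    ENNReal.inv_mul_le_iff (by simpa using Nat.centralBinom_ne_zero _) (by simp)] at hmain
  exact hmain

end RogersShephard

end MeasureTheory

theorem diff_le_sumset_sq_of_ge :
    ∃ C : ℝ, 0 < C ∧ ∀ n : ℕ, 1 ≤ n → ∀ A B : Set (Fin n → ℝ),
      IsCompact A → Convex ℝ A → 0 < volume A →
      IsCompact B → volume A ≤ volume B →
      (volume (A - A)).toReal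
        ≤ C * (volume (A + B)).toReal ^ 2 / (Real.sqrt n * (volume A).toReal) := by
  refine ⟨1, one_pos, fun n hn A B hA hA_conv hA₀ hB hAB ↦ ?_⟩
  obtain ⟨m, rfl⟩ := Nat.exists_eq_add_of_le' hn
  have hA_top : volume A ≠ ⊤ := hA.measure_lt_top.ne
  have hAB_top : volume (A + B) ^ 2 ≠ ⊤ := ENNReal.pow_ne_top (hA.add hB).measure_lt_top.ne
  have hdiff := ENNReal.toReal_mono (by finiteness)
    (hA_conv.measure_sub_le_centralBinom_mul volume hA (m := m) (by simp) hA₀.ne')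
  have hsum := ENNReal.toReal_mono hAB_top
    ((mul_le_mul_right (mul_le_mul_right hAB _) _).trans (four_pow_mul_volume_mul_volume_le hA hB))
  simp only [ENNReal.toReal_mul, ENNReal.toReal_pow, ENNReal.toReal_natCast,
    ENNReal.toReal_ofNat] at hdiff hsum
  have ha : 0 < (volume A).toReal := ENNReal.toReal_pos hA₀.ne' hA_top
  have hn₀ : (0 : ℝ) < √(m + 1 : ℕ) := Real.sqrt_pos.2 (by positivity)
  rw [one_mul, le_div_iff₀ (by positivity)]
  calc (volume (A - A)).toReal * (√(m + 1 : ℕ) * (volume A).toReal)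
      ≤ ((m + 1).centralBinom * (volume A).toReal) * (√(m + 1 : ℕ) * (volume A).toReal) := by
        gcongr
    _ = ((m + 1).centralBinom * √(m + 1 : ℕ)) * ((volume A).toReal * (volume A).toReal) := by
        ring
    _ ≤ 4 ^ (m + 1) * ((volume A).toReal * (volume A).toReal) := by
        gcongr
        exact Nat.centralBinom_mul_sqrt_le _
    _ ≤ (volume (A + B)).toReal ^ 2 := hsum
end
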